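/- arXiv:2410.23362 — 11 statements merged into one kernel-verified Lean document; each statement's English description precedes it below -/
import Mathlib

section
/- Let w ∈ ℝ^n have all entries strictly positive, b ∈ ℝ, and let σ : ℝ → ℝ be continuous and satisfy the STFE property; let f(x) = σ(wᵀx + b) on [0,1]^n and let ẑ be the tie point of σ over [b, wᵀ𝟏 + b]. Then for every x ∈ [0,1]^n: conc(f,[0,1]^n)(x) = f(x) if x ∈ R_f; conc(f,[0,1]^n)(x) = σ(b) + ((σ(ẑ)−σ(b))/(ẑ−b))·wᵀx if x ∈ R_l; and conc(f,[0,1]^n)(x) = σ(b) + x_i·conc(f_{−i}−σ(b),[0,1]^{n−1})(x_{−i}/x_i) if x ∈ R_i for some i ∈ {1,…,n}, where the regions R_f, R_l, R_i are defined with this ẑ. -/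
noncomputable section

/-- `φ` is the concave envelope of `f` over `S`: the pointwise smallest concave
function on `S` that majorizes `f` on `S`. -/
def IsConcaveEnvelope {E : Type*} [AddCommMonoid E] [Module ℝ E]
    (S : Set E) (f φ : E → ℝ) : Prop :=
  ConcaveOn ℝ S φ ∧ (∀ x ∈ S, f x ≤ φ x) ∧
    ∀ h : E → ℝ, ConcaveOn ℝ S h → (∀ x ∈ S, f x ≤ h x) → ∀ x ∈ S, φ x ≤ h x

/-- `φ` is the convex envelope of `f` over `S`: the pointwise largest convex
function on `S` that minorizes `f` on `S`. -/
def IsConvexEnvelope {E : Type*} [AddCommMonoid E] [Module ℝ E]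
    (S : Set E) (f φ : E → ℝ) : Prop :=
  ConvexOn ℝ S φ ∧ (∀ x ∈ S, φ x ≤ f x) ∧
    ∀ h : E → ℝ, ConvexOn ℝ S h → (∀ x ∈ S, h x ≤ f x) → ∀ x ∈ S, h x ≤ φ x

/-- `zhat ∈ [ℓ,u]` witnesses the secant-then-function form of the concave
envelope of `σ` on `[ℓ,u]`. -/
def STFEwitness (σ : ℝ → ℝ) (ℓ u zhat : ℝ) : Prop :=
  zhat ∈ Set.Icc ℓ u ∧
    IsConcaveEnvelope (Set.Icc ℓ u) σ
      (fun z => if z < zhat then σ ℓ + (σ zhat - σ ℓ) / (zhat - ℓ) * (z - ℓ) else σ z)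

/-- The secant-then-function envelope (STFE) property. -/
def STFE (σ : ℝ → ℝ) : Prop :=
  ∀ ℓ u : ℝ, ℓ ≤ u → ∃ zhat, STFEwitness σ ℓ u zhat

/-- The tie point of `σ` over `[ℓ,u]`: the smallest STFE witness. -/
def IsTiePoint (σ : ℝ → ℝ) (ℓ u zhat : ℝ) : Prop :=
  STFEwitness σ ℓ u zhat ∧ ∀ z, STFEwitness σ ℓ u z → zhat ≤ z

/-- `σ` is S-shaped: convex then concave. -/
def SShaped (σ : ℝ → ℝ) : Prop :=
  ∃ zt : ℝ, ConvexOn ℝ (Set.Iic zt) σ ∧ ConcaveOn ℝ (Set.Ici zt) σ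

/-- The dot product `wᵀx`. -/
def dotp {n : ℕ} (w x : Fin n → ℝ) : ℝ := ∑ i, w i * x i

/-- The region `R_f` of `[0,1]^n`. Note `‖x‖` is the sup norm on `Fin n → ℝ`. -/
def Rf {n : ℕ} (w : Fin n → ℝ) (b zhat : ℝ) : Set (Fin n → ℝ) :=
  {x | x ∈ Set.Icc (0 : Fin n → ℝ) 1 ∧ zhat ≤ dotp w x + b}

/-- The region `R_l` of `[0,1]^n`. -/
def Rl {n : ℕ} (w : Fin n → ℝ) (b zhat : ℝ) : Set (Fin n → ℝ) :=
  {x | x ∈ Set.Icc (0 : Fin n → ℝ) 1 ∧ dotp w x + b < zhat ∧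
    zhat * ‖x‖ ≤ dotp w x + b * ‖x‖}

/-- The region `R_i` of `[0,1]^n`. -/
def Ri {n : ℕ} (w : Fin n → ℝ) (b zhat : ℝ) (i : Fin n) : Set (Fin n → ℝ) :=
  {x | x ∈ Set.Icc (0 : Fin n → ℝ) 1 ∧ dotp w x + b * ‖x‖ < zhat * ‖x‖ ∧
    (∀ j, j < i → x j < x i) ∧ (∀ j, i ≤ j → x j ≤ x i)}

/-- `D'` is a face of the convex set `D`. -/
def IsFace {E : Type*} [AddCommGroup E] [Module ℝ E] (D D' : Set E) : Prop :=
  D' ⊆ D ∧ Convex ℝ D' ∧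
    ∀ x ∈ D, ∀ y ∈ D, ∀ t : ℝ, 0 < t → t < 1 →
      (1 - t) • x + t • y ∈ D' → x ∈ D' ∧ y ∈ D'


/-- The graph of `σ` on `[b, z]` lies below the chord from `b` to `z`. -/
def BelowChord (σ : ℝ → ℝ) (b z : ℝ) : Prop :=
  ∀ t ∈ Set.Icc b z, (σ t - σ b) * (z - b) ≤ (σ z - σ b) * (t - b)

/-- The increment `σ (b + t) - σ b`, continued past `z` by the line through the chord
from `b` to `z`. -/
def chordExtension (σ : ℝ → ℝ) (b z t : ℝ) : ℝ :=
  if b + t ≤ z then σ (b + t) - σ b else (σ z - σ b) / (z - b) * t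

lemma ConcaveOn.three_point {S : Set ℝ} {g : ℝ → ℝ} (hg : ConcaveOn ℝ S g) {a m c : ℝ}
    (ha : a ∈ S) (hc : c ∈ S) (ham : a ≤ m) (hmc : m ≤ c) :
    (c - m) * g a + (m - a) * g c ≤ (c - a) * g m := by
  rcases eq_or_lt_of_le (ham.trans hmc) with h | h
  · have h1 : m = a := by linarith
    subst h1 h
    simp
  have hca : 0 < c - a := by linarith
  have hca' : c - a ≠ 0 := hca.ne'
  have h1 : 0 ≤ (c - m) / (c - a) := div_nonneg (by linarith) hca.le
  have h2 : 0 ≤ (m - a) / (c - a) := div_nonneg (by linarith) hca.le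
  have h3 : (c - m) / (c - a) + (m - a) / (c - a) = 1 := by
    rw [← add_div, sub_add_sub_cancel, div_self hca']
  have key := hg.2 ha hc h1 h2 h3
  simp only [smul_eq_mul] at key
  have hm : (c - m) / (c - a) * a + (m - a) / (c - a) * c = m := by field_simp; ring
  rw [hm] at key
  have := mul_le_mul_of_nonneg_left key hca.le
  calc (c - m) * g a + (m - a) * g c
      = (c - a) * ((c - m) / (c - a) * g a + (m - a) / (c - a) * g c) := by field_simp
    _ ≤ _ := this

lemma STFEwitness.exists_envelope {σ : ℝ → ℝ} {l u z : ℝ} (h : STFEwitness σ l u z) :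
    ∃ g : ℝ → ℝ, ConcaveOn ℝ (Set.Icc l u) g ∧ (∀ t ∈ Set.Icc l u, σ t ≤ g t) ∧
      (∀ t, z ≤ t → g t = σ t) ∧ g l = σ l ∧
      ∀ t, t ≤ z → l < z → g t = σ l + (σ z - σ l) / (z - l) * (t - l) := by
  obtain ⟨⟨hlz, hzu⟩, hc, hm, -⟩ := h
  refine ⟨_, hc, hm, ?_, ?_, ?_⟩
  · intro t ht
    simp [not_lt.2 ht]
  · split_ifs <;> simp
  · intro t ht hlz'
    split_ifs with h1
    · rfl
    · obtain rfl : t = z := le_antisymm ht (not_lt.1 h1)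
      rw [div_mul_cancel₀ _ (sub_pos.2 hlz').ne', add_sub_cancel]

lemma STFEwitness.le_chord {σ : ℝ → ℝ} {l u z : ℝ} (h : STFEwitness σ l u z)
    {t : ℝ} (ht : t ∈ Set.Icc l u) :
    (σ t - σ l) * (z - l) ≤ (σ z - σ l) * (t - l) := by
  obtain ⟨g, hc, hm, hge, hl, hlin⟩ := h.exists_envelope
  have hz := h.1
  rcases le_total t z with htz | htz
  · rcases eq_or_lt_of_le hz.1 with h1 | h1
    · have : t = l := by linarith [ht.1]
      subst this
      simp
    · have h2 := hm t ht
      rw [hlin t htz h1] at h2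
      have h3 : 0 < z - l := by linarith
      have h4 : σ t - σ l ≤ (σ z - σ l) / (z - l) * (t - l) := by linarith
      calc (σ t - σ l) * (z - l) ≤ (σ z - σ l) / (z - l) * (t - l) * (z - l) :=
            mul_le_mul_of_nonneg_right h4 h3.le
        _ = _ := by field_simp
  · have := hc.three_point (a := l) (m := z) (c := t) ⟨le_rfl, ht.1.trans ht.2⟩ ht hz.1 htz
    rw [hl, hge z le_rfl, hge t htz] at this
    linarith

lemma STFEwitness.belowChord {σ : ℝ → ℝ} {l u z : ℝ} (h : STFEwitness σ l u z) :
    BelowChord σ l z :=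
  fun _ ht => h.le_chord ⟨ht.1, ht.2.trans h.1.2⟩

lemma BelowChord.mono {σ : ℝ → ℝ} (hσ : Continuous σ) (hS : STFE σ) {b z u : ℝ}
    (h : BelowChord σ b z) (hu : u ∈ Set.Icc b z) : BelowChord σ b u := by
  intro t ht
  by_contra! hlt
  have htb : b < t := by
    rcases eq_or_lt_of_le ht.1 with h1 | h1
    · subst h1; simp at hlt
    · exact h1
  have hub : b < u := htb.trans_le ht.2
  have ht0 : 0 < t - b := by linarith
  have hu0 : 0 < u - b := by linarith
  obtain ⟨c, hc1, hc2⟩ : ∃ c, (σ u - σ b) / (u - b) < c ∧ c < (σ t - σ b) / (t - b) :=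
    exists_between ((div_lt_div_iff₀ hu0 ht0).2 hlt)
  rw [div_lt_iff₀ hu0] at hc1
  rw [lt_div_iff₀ ht0] at hc2
  have hz0 : 0 < z - b := by linarith [hu.2]
  have hcz : c * (z - b) < σ z - σ b := by
    have h1 := h t ⟨ht.1, ht.2.trans hu.2⟩
    by_contra! h2
    have h3 := mul_le_mul_of_nonneg_right h2 ht0.le
    have h4 := mul_lt_mul_of_pos_right hc2 hz0
    nlinarith
  set d : ℝ → ℝ := fun s => σ s - σ b - c * (s - b) with hd
  have hdc : Continuous d := by fun_prop
  have hdu : d u < 0 := by simp only [hd]; linarith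
  have hdt : 0 < d t := by simp only [hd]; linarith
  have hdz : 0 < d z := by simp only [hd]; linarith
  have hcomp : IsCompact (Set.Icc u z ∩ d ⁻¹' {0}) :=
    isCompact_Icc.inter_right (isClosed_singleton.preimage hdc)
  obtain ⟨v₀, hv₀, hv₀'⟩ := intermediate_value_Icc hu.2 hdc.continuousOn ⟨hdu.le, hdz.le⟩
  obtain ⟨v, ⟨hv, hdv⟩, hmin⟩ := hcomp.exists_isLeast ⟨v₀, hv₀, hv₀'⟩
  replace hdv : d v = 0 := hdv
  obtain ⟨p, hp⟩ := hS b v (hub.le.trans hv.1)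
  obtain ⟨g, hgc, hgm, hge, hgb, hlin⟩ := hp.exists_envelope
  have hpv := hp.1
  have hup : u < p := by
    by_contra! hpu
    have h1 := hgc.three_point (a := b) (m := u) (c := v) ⟨le_rfl, hub.le.trans hv.1⟩
      ⟨hub.le.trans hv.1, le_rfl⟩ hub.le hv.1
    rw [hgb, hge u hpu, hge v hpv.2] at h1
    have h2 : σ v = σ b + c * (v - b) := by simp only [hd] at hdv; linarith
    rw [h2] at h1
    have hvb : 0 < v - b := by linarith [hv.1]
    have h3 := mul_lt_mul_of_pos_left hc1 hvb
    nlinarith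
  have hdp : 0 < d p := by
    have h1 := hp.le_chord (t := t) ⟨ht.1, ht.2.trans hv.1⟩
    have hp0 : 0 < p - b := by linarith
    have h2 := mul_lt_mul_of_pos_right hc2 hp0
    have h3 : (c * (p - b)) * (t - b) < (σ p - σ b) * (t - b) := by linarith
    have h4 := lt_of_mul_lt_mul_right h3 ht0.le
    simp only [hd]; linarith
  obtain ⟨q, hq, hq0⟩ := intermediate_value_Icc hup.le hdc.continuousOn ⟨hdu.le, hdp.le⟩
  have hvq : v ≤ q := hmin ⟨⟨hq.1, (hq.2.trans hpv.2).trans hv.2⟩, hq0⟩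
  have : p = v := le_antisymm hpv.2 (hvq.trans hq.2)
  rw [this] at hdp
  linarith

lemma BelowChord.le_slope {σ : ℝ → ℝ} {b z t : ℝ} (h : BelowChord σ b z) (hbz : b < z)
    (ht : t ∈ Set.Icc b z) : σ t - σ b ≤ (σ z - σ b) / (z - b) * (t - b) := by
  have h0 : 0 < z - b := by linarith
  rw [div_mul_eq_mul_div, le_div_iff₀ h0]
  exact h t ht

lemma chordExtension_le_slope_mul {σ : ℝ → ℝ} {b z t : ℝ} (h : BelowChord σ b z) (hbz : b < z)
    (ht : 0 ≤ t) : chordExtension σ b z t ≤ (σ z - σ b) / (z - b) * t := by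
  unfold chordExtension
  split_ifs with h1
  · simpa using h.le_slope hbz (t := b + t) ⟨by linarith, h1⟩
  · rfl

lemma chordExtension_smul_le {σ : ℝ → ℝ} (hσ : Continuous σ) (hS : STFE σ) {b z t r : ℝ}
    (h : BelowChord σ b z) (hbz : b < z) (ht : 0 ≤ t) (hr0 : 0 ≤ r) (hr1 : r ≤ 1) :
    chordExtension σ b z (r * t) ≤ r * chordExtension σ b z t := by
  have hrt : r * t ≤ t := by nlinarith
  have hrt0 : 0 ≤ r * t := by positivity
  by_cases h1 : b + t ≤ z
  · rcases eq_or_lt_of_le ht with h2 | h2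
    · subst h2
      simp [chordExtension, hbz.le]
    · have h3 := (h.mono hσ hS (u := b + t) ⟨by linarith, h1⟩).le_slope (by linarith)
        (t := b + r * t) ⟨by linarith, by linarith⟩
      unfold chordExtension
      rw [if_pos h1, if_pos (by linarith)]
      refine h3.trans (le_of_eq ?_)
      simp only [add_sub_cancel_left]
      field_simp
  · refine (chordExtension_le_slope_mul h hbz hrt0).trans (le_of_eq ?_)
    unfold chordExtension
    rw [if_neg h1]
    ring

lemma chordExtension_le_of_affine {σ : ℝ → ℝ} (hσ : Continuous σ) (hS : STFE σ)
    {b z W τ c : ℝ} (h : BelowChord σ b z) (hbW : b < W) (hWz : W < z)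
    (hc : (σ z - σ b) / (z - b) ≤ c)
    (hτ : ∀ t ∈ Set.Icc W z, σ t - σ b ≤ τ + c * (t - W))
    {r p : ℝ} (hp : 0 ≤ p) (hr0 : 0 ≤ r) (hr1 : r ≤ 1) :
    chordExtension σ b z (p + r * (W - b)) ≤ r * τ + c * p := by
  have hbz := hbW.trans hWz
  rcases eq_or_lt_of_le hr0 with h0 | h0
  · subst h0
    simp only [zero_mul, add_zero, zero_add]
    exact (chordExtension_le_slope_mul h hbz hp).trans (mul_le_mul_of_nonneg_right hc hp)
  · have hpr : 0 ≤ p / r := by positivity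
    have h1 : chordExtension σ b z (p / r + (W - b)) ≤ τ + c * (p / r) := by
      unfold chordExtension
      split_ifs with h2
      · have h3 := hτ (b + (p / r + (W - b))) ⟨by linarith, h2⟩
        have h4 : b + (p / r + (W - b)) - W = p / r := by ring
        rwa [h4] at h3
      · have h3 := hτ z ⟨hWz.le, le_rfl⟩
        have hz0 : z - b ≠ 0 := by linarith
        set s := (σ z - σ b) / (z - b) with hs
        have h4 : s * (z - b) = σ z - σ b := by rw [hs]; field_simp
        nlinarith
    have h2 := chordExtension_smul_le hσ hS h hbz (t := p / r + (W - b)) (by linarith) hr0 hr1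
    have h3 : r * (p / r + (W - b)) = p + r * (W - b) := by field_simp
    rw [h3] at h2
    calc _ ≤ _ := h2
      _ ≤ r * (τ + c * (p / r)) := mul_le_mul_of_nonneg_left h1 hr0
      _ = _ := by field_simp

/-- The chord slope at a later base point dominates the chord slope at an earlier one. -/
lemma slope_le_of_witness {σ : ℝ → ℝ} {b z W z' : ℝ} (h : BelowChord σ b z) (hbW : b < W)
    (hWz : W < z) (hw : STFEwitness σ W z z') (hWz' : W < z') :
    (σ z - σ b) / (z - b) ≤ (σ z' - σ W) / (z' - W) := by
  have h1 := h W ⟨hbW.le, hWz.le⟩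
  have h2 := hw.le_chord (t := z) ⟨hWz.le, le_rfl⟩
  have h3 : (σ z - σ b) / (z - b) ≤ (σ z - σ W) / (z - W) := by
    rw [div_le_div_iff₀ (by linarith) (by linarith)]
    nlinarith
  refine h3.trans ?_
  rw [div_le_div_iff₀ (by linarith) (by linarith)]
  exact h2

lemma chordExtension_le_witness_slope {σ : ℝ → ℝ} (hσ : Continuous σ) (hS : STFE σ)
    {b z W z' : ℝ} (h : BelowChord σ b z) (hbW : b < W) (hWz : W < z)
    (hw : STFEwitness σ W z z') (hWz' : W < z')
    {r p : ℝ} (hp : 0 ≤ p) (hr0 : 0 ≤ r) (hr1 : r ≤ 1) :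
    chordExtension σ b z (p + r * (W - b)) ≤
      r * (σ W - σ b) + (σ z' - σ W) / (z' - W) * p := by
  refine chordExtension_le_of_affine hσ hS h hbW hWz (slope_le_of_witness h hbW hWz hw hWz')
    ?_ hp hr0 hr1
  intro t ht
  have h0 : 0 < z' - W := by linarith
  have h1 : σ t - σ W ≤ (σ z' - σ W) / (z' - W) * (t - W) := by
    rw [div_mul_eq_mul_div, le_div_iff₀ h0]
    exact hw.le_chord ht
  linarith

lemma chordExtension_add_le {σ : ℝ → ℝ} (hσ : Continuous σ) (hS : STFE σ)
    {b z W z' : ℝ} (h : BelowChord σ b z) (hbW : b < W) (hWz : W < z)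
    (hw : STFEwitness σ W z z') (hWz' : W < z')
    {r p : ℝ} (hp : 0 ≤ p) (hr0 : 0 ≤ r) (hr1 : r ≤ 1) :
    chordExtension σ b z (p + r * (W - b)) ≤ r * (σ W - σ b) + chordExtension σ W z' p := by
  by_cases hpz : W + p ≤ z'
  swap
  · have := chordExtension_le_witness_slope hσ hS h hbW hWz hw hWz' hp hr0 hr1
    rwa [chordExtension.eq_1 σ W z' p, if_neg hpz]
  have hW0 : 0 < W - b := by linarith
  have hrW : r * (W - b) ≤ W - b := by nlinarith
  have hrW0 : 0 ≤ r * (W - b) := by positivity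
  have hz'z := hw.1.2
  rw [chordExtension, if_pos (by linarith), chordExtension, if_pos hpz]
  rcases eq_or_lt_of_le hp with h0 | hp0
  · subst h0
    have := (h.mono hσ hS (u := W) ⟨hbW.le, hWz.le⟩).le_slope hbW
      (t := b + (0 + r * (W - b))) ⟨by linarith, by linarith⟩
    refine this.trans (le_of_eq ?_)
    rw [add_zero W, sub_self, add_zero, zero_add, add_sub_cancel_left]
    field_simp
  have hslope : (σ W - σ b) * p ≤ (σ (W + p) - σ W) * (W - b) := by
    have := h.mono hσ hS (u := W + p) ⟨by linarith, by linarith⟩ W ⟨hbW.le, by linarith⟩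
    linarith
  set c := (σ (W + p) - σ W) / p with hc
  have hcp : σ (W + p) - σ W = c * p := by rw [hc]; field_simp
  have hcW : σ W - σ b ≤ c * (W - b) := by
    rw [hcp] at hslope
    have h1 : (σ W - σ b) * p ≤ (c * (W - b)) * p := by linarith
    exact le_of_mul_le_mul_right h1 hp0
  rw [hcp]
  set t := b + (p + r * (W - b)) with ht
  rcases le_total W t with hWt | htW
  · have h1 := (hw.belowChord.mono hσ hS (u := W + p) ⟨by linarith, hpz⟩).le_slope
      (by linarith) (t := t) ⟨hWt, by linarith⟩
    rw [hcp, add_sub_cancel_left, mul_div_cancel_right₀ _ hp0.ne'] at h1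
    have h2 := mul_le_mul_of_nonneg_left hcW (sub_nonneg.2 hr1)
    have h3 : t - W = p - (1 - r) * (W - b) := by rw [ht]; ring
    rw [h3] at h1
    linarith
  · have h1 := (h.mono hσ hS (u := W) ⟨hbW.le, hWz.le⟩).le_slope hbW
      (t := t) ⟨by linarith, htW⟩
    set ρ := (σ W - σ b) / (W - b) with hρ
    have h2 : σ W - σ b = ρ * (W - b) := by rw [hρ]; field_simp
    have h3 : t - b = p + r * (W - b) := by rw [ht]; ring
    rw [h3] at h1
    have h4 : ρ ≤ c := by
      rw [h2] at hcW
      exact le_of_mul_le_mul_right hcW hW0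
    have h5 := mul_le_mul_of_nonneg_right h4 hp
    rw [h2]
    linarith

lemma exists_affine_majorant {σ : ℝ → ℝ} (hσ : Continuous σ) {W z z' T s : ℝ}
    (hw : STFEwitness σ W z z') (hT : z' ≤ T) (hTz : T < z)
    (hs : ∀ t ∈ Set.Icc W z, σ t ≤ σ z + s * (t - z)) {ε : ℝ} (hε : 0 < ε) :
    ∃ c, s ≤ c ∧ ∀ t ∈ Set.Icc W z, σ t ≤ σ T + ε + c * (t - T) := by
  obtain ⟨g, hgc, hgm, hge, -, -⟩ := hw.exists_envelope
  have hWT : W ≤ T := hw.1.1.trans hT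
  obtain ⟨δ, hδ, hball⟩ := Metric.continuous_iff.1 hσ T (ε / 2) (by linarith)
  obtain ⟨T₁, hT₁, hT₁'⟩ : ∃ T₁, T < T₁ ∧ T₁ < min z (T + δ) :=
    exists_between (lt_min hTz (by linarith))
  have hT₁z : T₁ < z := hT₁'.trans_le (min_le_left _ _)
  have hT₁δ : T₁ < T + δ := hT₁'.trans_le (min_le_right _ _)
  have hnear : ∀ t ∈ Set.Icc T T₁, |σ t - σ T| < ε / 2 := by
    intro t ht
    have := hball t (by rw [Real.dist_eq, abs_of_nonneg (by linarith [ht.1])]; linarith [ht.2])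
    rwa [Real.dist_eq] at this
  have hd : 0 < T₁ - T := by linarith
  set c := (σ T₁ - σ T) / (T₁ - T) with hc
  have hcd : σ T₁ - σ T = c * (T₁ - T) := by rw [hc]; field_simp
  have hgT := hge T hT
  have hgT₁ := hge T₁ (hT.trans hT₁.le)
  have hTm : T ∈ Set.Icc W z := ⟨hWT, hTz.le⟩
  have hT₁m : T₁ ∈ Set.Icc W z := ⟨hWT.trans hT₁.le, hT₁z.le⟩
  refine ⟨c, ?_, ?_⟩
  · have h1 := hgc.three_point hTm (c := z) ⟨hWT.trans hTz.le, le_rfl⟩ hT₁.le hT₁z.le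
    rw [hgT, hgT₁, hge z (hT.trans hTz.le)] at h1
    have h2 := hs T₁ hT₁m
    have h3 : 0 < z - T₁ := by linarith
    have h4 : s * (z - T₁) ≤ c * (z - T₁) := by
      have h5 : σ z - σ T₁ ≤ c * (z - T₁) := by
        have h6 : (σ z - σ T₁) * (T₁ - T) ≤ (c * (z - T₁)) * (T₁ - T) := by
          have : (z - T₁) * (σ T₁ - σ T) = (z - T₁) * (c * (T₁ - T)) := by rw [hcd]
          linarith
        exact le_of_mul_le_mul_right h6 hd
      linarith
    exact le_of_mul_le_mul_right h4 h3
  · intro t ht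
    rcases le_total t T with h1 | h1
    · have h2 := hgc.three_point ht hT₁m h1 hT₁.le
      rw [hgT, hgT₁] at h2
      have h3 := hgm t ht
      have h4 : σ T₁ = σ T + c * (T₁ - T) := by linarith
      rw [h4] at h2
      have h5 : (T₁ - T) * g t ≤ (T₁ - T) * (σ T + c * (t - T)) := by linarith
      have := le_of_mul_le_mul_left h5 hd
      linarith
    rcases le_total t T₁ with h2 | h2
    · have h3 := abs_lt.1 (hnear t ⟨h1, h2⟩)
      have h4 := abs_lt.1 (hnear T₁ ⟨hT₁.le, le_rfl⟩)
      have h5 : -(ε / 2) ≤ c * (t - T) := by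
        rcases le_total 0 c with h6 | h6
        · have := mul_nonneg h6 (sub_nonneg.2 h1)
          linarith
        · have : c * (T₁ - T) ≤ c * (t - T) := mul_le_mul_of_nonpos_left (by linarith) h6
          linarith
      linarith
    · have h3 := hgc.three_point hTm ht hT₁.le h2
      rw [hgT, hgT₁] at h3
      have h4 := hgm t ht
      have h5 : σ T₁ = σ T + c * (T₁ - T) := by linarith
      rw [h5] at h3
      have h6 : (T₁ - T) * g t ≤ (T₁ - T) * (σ T + c * (t - T)) := by linarith
      have := le_of_mul_le_mul_left h6 hd
      linarith

lemma dotp_nonneg {n : ℕ} {w x : Fin n → ℝ} (hw : ∀ i, 0 < w i) (hx : ∀ i, 0 ≤ x i) :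
    0 ≤ dotp w x :=
  Finset.sum_nonneg fun i _ => mul_nonneg (hw i).le (hx i)

lemma dotp_add {n : ℕ} (w x y : Fin n → ℝ) : dotp w (x + y) = dotp w x + dotp w y := by
  simp [dotp, mul_add, Finset.sum_add_distrib]

lemma dotp_smul {n : ℕ} (w : Fin n → ℝ) (c : ℝ) (x : Fin n → ℝ) :
    dotp w (c • x) = c * dotp w x := by
  simp only [dotp, Finset.mul_sum, Pi.smul_apply, smul_eq_mul]
  exact Finset.sum_congr rfl fun _ _ => by ring

lemma dotp_smul_left {n : ℕ} (w : Fin n → ℝ) (c : ℝ) (x : Fin n → ℝ) :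
    dotp (c • w) x = c * dotp w x := by
  simp only [dotp, Finset.mul_sum, Pi.smul_apply, smul_eq_mul]
  exact Finset.sum_congr rfl fun _ _ => by ring

lemma dotp_zero {n : ℕ} (w : Fin n → ℝ) : dotp w 0 = 0 := by simp [dotp]

lemma dotp_succAbove {n : ℕ} (w x : Fin (n + 1) → ℝ) (i : Fin (n + 1)) :
    dotp w x = w i * x i + dotp (fun j => w (i.succAbove j)) fun j => x (i.succAbove j) :=
  Fin.sum_univ_succAbove _ i

lemma concaveOn_comp_dotp {n : ℕ} (w : Fin n → ℝ) (b : ℝ) {s : Set (Fin n → ℝ)} {t : Set ℝ}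
    (hs : Convex ℝ s) {g : ℝ → ℝ} (hg : ConcaveOn ℝ t g)
    (hst : ∀ x ∈ s, dotp w x + b ∈ t) : ConcaveOn ℝ s fun x => g (dotp w x + b) := by
  refine ⟨hs, fun x hx y hy p q hp hq hpq => ?_⟩
  have := hg.2 (hst x hx) (hst y hy) hp hq hpq
  have h : dotp w (p • x + q • y) + b = p • (dotp w x + b) + q • (dotp w y + b) := by
    rw [dotp_add, dotp_smul, dotp_smul]
    simp only [smul_eq_mul]
    linear_combination (-b) * hpq
  simpa only [h] using this

/-- A concave majorant on the cube lies above the secant value wherever the ray through the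
point reaches the tie level inside the cube. -/
lemma secant_le_of_concaveOn {n : ℕ} {w : Fin n → ℝ} (hw : ∀ i, 0 < w i) {b z : ℝ}
    (hbz : b < z) {σ : ℝ → ℝ} {φ : (Fin n → ℝ) → ℝ} (hφ : ConcaveOn ℝ (Set.Icc 0 1) φ)
    (hm : ∀ x ∈ Set.Icc (0 : Fin n → ℝ) 1, σ (dotp w x + b) ≤ φ x)
    {x : Fin n → ℝ} (hx : x ∈ Set.Icc (0 : Fin n → ℝ) 1)
    (hle : dotp w x ≤ z - b) (hray : ∀ j, (z - b) * x j ≤ dotp w x) :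
    σ b + (σ z - σ b) / (z - b) * dotp w x ≤ φ x := by
  have hz0 : 0 < z - b := sub_pos.2 hbz
  have hx0 : ∀ j, 0 ≤ x j := fun j => hx.1 j
  have h00 : (0 : Fin n → ℝ) ∈ Set.Icc (0 : Fin n → ℝ) 1 := ⟨le_rfl, zero_le_one⟩
  have hφ0 : σ b ≤ φ 0 := by simpa [dotp_zero] using hm 0 h00
  rcases eq_or_lt_of_le (dotp_nonneg hw hx0) with h | h
  · have : x = 0 := by
      funext j
      have h1 := hray j
      rw [← h] at h1
      exact le_antisymm (by simpa using nonpos_of_mul_nonpos_right h1 hz0) (hx0 j)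
    rw [← h, this]
    simpa using hφ0
  set r := dotp w x / (z - b) with hr
  have hr0 : 0 < r := div_pos h hz0
  have hr1 : r ≤ 1 := (div_le_one hz0).2 hle
  have hrz : dotp w x = r * (z - b) := by rw [hr]; field_simp
  have hy : r⁻¹ • x ∈ Set.Icc (0 : Fin n → ℝ) 1 := by
    refine ⟨fun j => mul_nonneg (inv_nonneg.2 hr0.le) (hx0 j), fun j => ?_⟩
    have h1 : x j ≤ r := by
      rw [hr, le_div_iff₀ hz0, mul_comm]
      exact hray j
    simp only [Pi.smul_apply, smul_eq_mul, Pi.one_apply]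
    rwa [inv_mul_le_iff₀ hr0, mul_one]
  have h1 := hm _ hy
  rw [dotp_smul, hrz, inv_mul_cancel_left₀ hr0.ne', sub_add_cancel] at h1
  have h2 := hφ.2 h00 hy (sub_nonneg.2 hr1) hr0.le (sub_add_cancel 1 r)
  rw [smul_zero, zero_add, smul_inv_smul₀ hr0.ne'] at h2
  simp only [smul_eq_mul] at h2
  have h3 := mul_le_mul_of_nonneg_left hφ0 (sub_nonneg.2 hr1)
  have h4 := mul_le_mul_of_nonneg_left h1 hr0.le
  have h5 : (σ z - σ b) / (z - b) * dotp w x = r * (σ z - σ b) := by rw [hr]; ring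
  rw [h5]
  linarith

lemma insertNth_mem_Icc {n : ℕ} (i : Fin (n + 1)) {y : Fin n → ℝ}
    (hy : y ∈ Set.Icc (0 : Fin n → ℝ) 1) :
    i.insertNth (1 : ℝ) y ∈ Set.Icc (0 : Fin (n + 1) → ℝ) 1 := by
  constructor
  · intro j
    rcases Fin.eq_self_or_eq_succAbove i j with rfl | ⟨k, rfl⟩
    · simp
    · simpa using hy.1 k
  · intro j
    rcases Fin.eq_self_or_eq_succAbove i j with rfl | ⟨k, rfl⟩
    · simp
    · simpa using hy.2 k

lemma concaveOn_comp_insertNth {n : ℕ} (i : Fin (n + 1)) {φ : (Fin (n + 1) → ℝ) → ℝ}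
    (hφ : ConcaveOn ℝ (Set.Icc 0 1) φ) :
    ConcaveOn ℝ (Set.Icc (0 : Fin n → ℝ) 1) fun y => φ (i.insertNth (1 : ℝ) y) := by
  refine ⟨convex_Icc _ _, fun x hx y hy p q hp hq hpq => ?_⟩
  have h := hφ.2 (insertNth_mem_Icc i hx) (insertNth_mem_Icc i hy) hp hq hpq
  have h' : (i.insertNth (1 : ℝ) (p • x + q • y) : Fin (n + 1) → ℝ) =
      p • (i.insertNth (1 : ℝ) x : Fin (n + 1) → ℝ) +
        q • (i.insertNth (1 : ℝ) y : Fin (n + 1) → ℝ) := by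
    funext j
    rcases Fin.eq_self_or_eq_succAbove i j with rfl | ⟨k, rfl⟩
    · simp [hpq]
    · simp
  simp only [h']
  exact h

lemma div_mem_Icc {n : ℕ} {x : Fin (n + 1) → ℝ} {i : Fin (n + 1)} (hi : 0 < x i)
    (hx : ∀ j, 0 ≤ x j) (hmax : ∀ j, x j ≤ x i) :
    (fun j => x (i.succAbove j) / x i) ∈ Set.Icc (0 : Fin n → ℝ) 1 :=
  ⟨fun _ => div_nonneg (hx _) hi.le, fun _ => (div_le_one hi).2 (hmax _)⟩

lemma face_le_of_concaveOn {n : ℕ} {φ : (Fin (n + 1) → ℝ) → ℝ}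
    (hφ : ConcaveOn ℝ (Set.Icc 0 1) φ) {x : Fin (n + 1) → ℝ}
    (hx : x ∈ Set.Icc (0 : Fin (n + 1) → ℝ) 1) {i : Fin (n + 1)} (hi : 0 < x i)
    (hmax : ∀ j, x j ≤ x i) :
    (1 - x i) * φ 0 + x i * φ (i.insertNth (1 : ℝ) fun j => x (i.succAbove j) / x i) ≤ φ x := by
  have hi1 : x i ≤ 1 := hx.2 i
  have h := hφ.2 (x := 0) ⟨le_rfl, zero_le_one⟩
    (insertNth_mem_Icc i (div_mem_Icc hi (fun j => hx.1 j) hmax))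
    (sub_nonneg.2 hi1) hi.le (sub_add_cancel 1 (x i))
  have h' : (1 - x i) • (0 : Fin (n + 1) → ℝ) +
      x i • (i.insertNth (1 : ℝ) (fun j => x (i.succAbove j) / x i) : Fin (n + 1) → ℝ) = x := by
    funext j
    rcases Fin.eq_self_or_eq_succAbove i j with rfl | ⟨k, rfl⟩
    · simp
    · simp [mul_div_cancel₀ _ hi.ne']
  rw [h'] at h
  simpa only [smul_eq_mul] using h

/-- Near-optimal linear majorants exist at every point of `[0,1]^n` whose ray leaves the cube
before reaching the level `z`. -/
def HasLinearMajorants (σ : ℝ → ℝ) (n : ℕ) : Prop :=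
  ∀ (b z : ℝ), b < z → BelowChord σ b z → ∀ w : Fin n → ℝ, (∀ i, 0 < w i) →
    ∀ φ : (Fin n → ℝ) → ℝ, ConcaveOn ℝ (Set.Icc 0 1) φ →
    (∀ y ∈ Set.Icc (0 : Fin n → ℝ) 1, σ (dotp w y + b) ≤ φ y) →
    ∀ x ∈ Set.Icc (0 : Fin n → ℝ) 1, ∀ i, (∀ j, x j ≤ x i) → dotp w x < (z - b) * x i →
    ∀ ε > 0, ∃ l : Fin n → ℝ,
      (∀ y ∈ Set.Icc (0 : Fin n → ℝ) 1, chordExtension σ b z (dotp w y) ≤ dotp l y) ∧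
      σ b + dotp l x ≤ φ x + ε

lemma exists_face_majorant {σ : ℝ → ℝ} (hσ : Continuous σ) (hS : STFE σ) {n : ℕ}
    (ih : HasLinearMajorants σ n) {b z : ℝ} (hc : BelowChord σ b z) {W : ℝ} (hbW : b < W)
    {w : Fin n → ℝ} (hw : ∀ i, 0 < w i) {ψ : (Fin n → ℝ) → ℝ}
    (hψ : ConcaveOn ℝ (Set.Icc 0 1) ψ)
    (hm : ∀ y ∈ Set.Icc (0 : Fin n → ℝ) 1, σ (dotp w y + W) ≤ ψ y)
    {x : Fin n → ℝ} (hx : x ∈ Set.Icc (0 : Fin n → ℝ) 1) (hxz : dotp w x + W < z)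
    {ε : ℝ} (hε : 0 < ε) :
    ∃ (τ : ℝ) (l : Fin n → ℝ),
      (∀ y ∈ Set.Icc (0 : Fin n → ℝ) 1, ∀ r : ℝ, 0 ≤ r → r ≤ 1 →
        chordExtension σ b z (dotp w y + r * (W - b)) ≤ r * τ + dotp l y) ∧
      τ + dotp l x ≤ ψ x - σ b + ε := by
  have hx0 := dotp_nonneg hw fun j => hx.1 j
  have hWz : W < z := by linarith
  have hy0 : ∀ y ∈ Set.Icc (0 : Fin n → ℝ) 1, 0 ≤ dotp w y :=
    fun y hy => dotp_nonneg hw fun j => hy.1 j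
  obtain ⟨z', hz'⟩ := hS W z hWz.le
  rcases le_or_gt z' (dotp w x + W) with hT | hT
  · have hz0 : z - b ≠ 0 := by linarith
    set s := (σ z - σ b) / (z - b) with hs
    have hs' : σ z - σ b = s * (z - b) := by rw [hs]; field_simp
    obtain ⟨c, hsc, hcm⟩ := exists_affine_majorant hσ hz' hT hxz (s := s) (fun t ht => by
      have := hc.le_slope (by linarith) (t := t) ⟨by linarith [ht.1], ht.2⟩
      linarith) hε
    refine ⟨σ (dotp w x + W) - σ b + ε - c * dotp w x, c • w, ?_, ?_⟩
    · intro y hy r hr0 hr1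
      rw [dotp_smul_left]
      refine chordExtension_le_of_affine hσ hS hc hbW hWz hsc ?_ (hy0 y hy) hr0 hr1
      intro t ht
      have := hcm t ht
      linarith
    · rw [dotp_smul_left]
      have := hm x hx
      linarith
  have hWz' : W < z' := by linarith
  by_cases hray : ∀ j, (z' - W) * x j ≤ dotp w x
  · refine ⟨σ W - σ b, ((σ z' - σ W) / (z' - W)) • w, ?_, ?_⟩
    · intro y hy r hr0 hr1
      rw [dotp_smul_left]
      exact chordExtension_le_witness_slope hσ hS hc hbW hWz hz' hWz' (hy0 y hy) hr0 hr1
    · rw [dotp_smul_left]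
      have := secant_le_of_concaveOn hw hWz' hψ hm hx (by linarith) hray
      linarith
  · push Not at hray
    obtain ⟨j, hj⟩ := hray
    obtain ⟨i, -, hi⟩ := Finset.exists_max_image Finset.univ x ⟨j, Finset.mem_univ j⟩
    obtain ⟨l, hl, hlx⟩ := ih W z' hWz' hz'.belowChord w hw ψ hψ hm x hx i
      (fun k => hi k (Finset.mem_univ k))
      (hj.trans_le (mul_le_mul_of_nonneg_left (hi j (Finset.mem_univ j)) (by linarith))) ε hε
    refine ⟨σ W - σ b, l, ?_, by linarith⟩
    intro y hy r hr0 hr1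
    have h1 := chordExtension_add_le hσ hS hc hbW hWz hz' hWz' (hy0 y hy) hr0 hr1
    have h2 := hl y hy
    linarith

lemma exists_linear_majorant_of_face {σ : ℝ → ℝ} (hσ : Continuous σ) (hS : STFE σ) {n : ℕ}
    (ih : HasLinearMajorants σ n) {b z : ℝ} (hbz : b < z) (hc : BelowChord σ b z)
    {w : Fin (n + 1) → ℝ} (hw : ∀ i, 0 < w i) (i : Fin (n + 1)) {ψ : (Fin n → ℝ) → ℝ}
    (hψ : ConcaveOn ℝ (Set.Icc 0 1) ψ)
    (hm : ∀ y ∈ Set.Icc (0 : Fin n → ℝ) 1,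
      σ (dotp (fun j => w (i.succAbove j)) y + (w i + b)) ≤ ψ y)
    {x : Fin (n + 1) → ℝ} (hx : x ∈ Set.Icc (0 : Fin (n + 1) → ℝ) 1)
    (hmax : ∀ j, x j ≤ x i) (hxz : dotp w x < (z - b) * x i) {ε : ℝ} (hε : 0 < ε) :
    0 < x i ∧ ∃ l : Fin (n + 1) → ℝ,
      (∀ y ∈ Set.Icc (0 : Fin (n + 1) → ℝ) 1, chordExtension σ b z (dotp w y) ≤ dotp l y) ∧
      dotp l x ≤ x i * (ψ (fun j => x (i.succAbove j) / x i) - σ b + ε) := by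
  have hx0 := dotp_nonneg hw fun j => hx.1 j
  have hi : 0 < x i := pos_of_mul_pos_right (hx0.trans_lt hxz) (by linarith)
  refine ⟨hi, ?_⟩
  set x' : Fin n → ℝ := fun j => x (i.succAbove j) / x i with hx'
  have hx'' : (fun j => x (i.succAbove j)) = x i • x' := by
    funext j
    simp [hx', mul_div_cancel₀ _ hi.ne']
  have hlt : dotp (fun j => w (i.succAbove j)) x' + (w i + b) < z := by
    rw [dotp_succAbove w x i, hx'', dotp_smul] at hxz
    have : x i * (w i + dotp (fun j => w (i.succAbove j)) x') < x i * (z - b) := by linarith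
    have := lt_of_mul_lt_mul_left this hi.le
    linarith
  obtain ⟨τ, l, hl, hlx⟩ := exists_face_majorant hσ hS ih hc (W := w i + b)
    (by linarith [hw i]) (fun j => hw _) hψ hm (div_mem_Icc hi (fun j => hx.1 j) hmax) hlt hε
  refine ⟨i.insertNth τ l, ?_, ?_⟩
  · intro y hy
    have := hl (fun j => y (i.succAbove j)) ⟨fun j => hy.1 _, fun j => hy.2 _⟩ (y i)
      (hy.1 i) (hy.2 i)
    rw [dotp_succAbove w y i, dotp_succAbove _ y i]
    simp only [Fin.insertNth_apply_same, Fin.insertNth_apply_succAbove]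
    rw [add_sub_cancel_right] at this
    rw [add_comm (w i * y i), mul_comm (w i), mul_comm τ]
    exact this
  · rw [dotp_succAbove _ x i, hx'', dotp_smul]
    simp only [Fin.insertNth_apply_same, Fin.insertNth_apply_succAbove]
    have := mul_le_mul_of_nonneg_left hlx hi.le
    linarith

lemma hasLinearMajorants {σ : ℝ → ℝ} (hσ : Continuous σ) (hS : STFE σ) (n : ℕ) :
    HasLinearMajorants σ n := by
  induction n with
  | zero => exact fun _ _ _ _ _ _ _ _ _ _ _ i => i.elim0
  | succ n ih =>
    intro b z hbz hc w hw φ hφ hm x hx i hmax hxz ε hε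
    obtain ⟨hi, l, hl, hlx⟩ := exists_linear_majorant_of_face hσ hS ih hbz hc hw i
      (concaveOn_comp_insertNth i hφ) (fun y hy => by
        have := hm _ (insertNth_mem_Icc i hy)
        rw [dotp_succAbove w _ i] at this
        simp only [Fin.insertNth_apply_same, Fin.insertNth_apply_succAbove, mul_one] at this
        rwa [add_comm (w i), add_assoc] at this) hx hmax hxz hε
    refine ⟨l, hl, ?_⟩
    have hi1 : x i ≤ 1 := hx.2 i
    have h1 := face_le_of_concaveOn hφ hx hi hmax
    have h2 : σ b ≤ φ 0 := by
      simpa [dotp_zero] using hm 0 ⟨le_rfl, zero_le_one⟩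
    have h3 := mul_le_mul_of_nonneg_left h2 (sub_nonneg.2 hi1)
    have h4 : x i * ε ≤ 1 * ε := mul_le_mul_of_nonneg_right hi1 hε.le
    linarith

theorem stmt0 {n : ℕ} (w : Fin (n+1) → ℝ) (hw : ∀ i, 0 < w i) (b : ℝ)
    (σ : ℝ → ℝ) (hσ : Continuous σ) (hSTFE : STFE σ)
    (zhat : ℝ) (htie : IsTiePoint σ b ((∑ i, w i) + b) zhat)
    (φ : (Fin (n+1) → ℝ) → ℝ)
    (hφ : IsConcaveEnvelope (Set.Icc 0 1) (fun x => σ (dotp w x + b)) φ)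
    (ψ : Fin (n+1) → (Fin n → ℝ) → ℝ)
    (hψ : ∀ i, IsConcaveEnvelope (Set.Icc 0 1)
      (fun y : Fin n → ℝ => σ ((∑ j, w (i.succAbove j) * y j) + w i + b) - σ b) (ψ i)) :
    ∀ x ∈ Set.Icc (0 : Fin (n+1) → ℝ) 1,
      (x ∈ Rf w b zhat → φ x = σ (dotp w x + b)) ∧
      (x ∈ Rl w b zhat → φ x = σ b + (σ zhat - σ b) / (zhat - b) * dotp w x) ∧
      (∀ i : Fin (n+1), x ∈ Ri w b zhat i →
        φ x = σ b + x i * ψ i (fun j => x (i.succAbove j) / x i)) := by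
  intro x hx
  obtain ⟨hφc, hφm, hφmin⟩ := hφ
  have hw' := htie.1
  have hx0 : ∀ j, 0 ≤ x j := fun j => hx.1 j
  have hrange : ∀ y ∈ Set.Icc (0 : Fin (n + 1) → ℝ) 1,
      dotp w y + b ∈ Set.Icc b ((∑ i, w i) + b) := by
    intro y hy
    have h1 := dotp_nonneg hw fun j => hy.1 j
    have h2 : dotp w y ≤ ∑ i, w i :=
      Finset.sum_le_sum fun j _ => mul_le_of_le_one_right (hw j).le (hy.2 j)
    exact ⟨by linarith, by linarith⟩
  obtain ⟨g, hgc, hgm, hge, -, hlin⟩ := hw'.exists_envelope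
  have hφg : φ x ≤ g (dotp w x + b) :=
    hφmin _ (concaveOn_comp_dotp w b (convex_Icc _ _) hgc hrange)
      (fun y hy => hgm _ (hrange y hy)) x hx
  have hd := dotp_nonneg hw hx0
  have hxle : ∀ j, x j ≤ ‖x‖ := fun j => (le_abs_self _).trans (norm_le_pi_norm x j)
  refine ⟨?_, ?_, ?_⟩
  · rintro ⟨-, hz⟩
    exact le_antisymm (hφg.trans_eq (hge _ hz)) (hφm x hx)
  · rintro ⟨-, hz, hray⟩
    have hbz : b < zhat := by linarith
    rw [hlin _ hz.le hbz, add_sub_cancel_right] at hφg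
    refine le_antisymm hφg (secant_le_of_concaveOn hw hbz hφc hφm hx (by linarith) fun j => ?_)
    have := mul_le_mul_of_nonneg_left (hxle j) (sub_nonneg.2 hbz.le)
    linarith
  · rintro i ⟨-, hz, hlt, hge'⟩
    have hmax : ∀ j, x j ≤ x i := fun j =>
      (lt_or_ge j i).elim (fun h => (hlt j h).le) (hge' j)
    have hnorm : ‖x‖ = x i := by
      refine le_antisymm ((pi_norm_le_iff_of_nonneg (hx0 i)).2 fun j => ?_) (hxle i)
      rw [Real.norm_eq_abs, abs_of_nonneg (hx0 j)]
      exact hmax j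
    rw [hnorm] at hz
    have hxz : dotp w x < (zhat - b) * x i := by linarith
    have hbz : b < zhat := by
      by_contra! h
      have := mul_le_mul_of_nonneg_right h (hx0 i)
      linarith
    obtain ⟨hψc, hψm, hψmin⟩ := hψ i
    have hψm' : ∀ y ∈ Set.Icc (0 : Fin n → ℝ) 1,
        σ (dotp (fun j => w (i.succAbove j)) y + (w i + b)) ≤ ψ i y + σ b := by
      intro y hy
      have := hψm y hy
      rw [← add_assoc]
      exact sub_le_iff_le_add.1 this
    have hlinmaj : ∀ {ε : ℝ}, 0 < ε → _ := fun {ε} hε =>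
      exists_linear_majorant_of_face hσ hSTFE (hasLinearMajorants hσ hSTFE n) hbz
        hw'.belowChord hw i (hψc.add_const (σ b)) hψm' hx hmax hxz hε
    have hi1 : x i ≤ 1 := hx.2 i
    have hi : 0 < x i := (hlinmaj one_pos).1
    refine le_antisymm (le_of_forall_pos_le_add fun ε hε => ?_) ?_
    · obtain ⟨-, l, hl, hlx⟩ := hlinmaj hε
      have h1 := hφmin (fun y => dotp l y + σ b)
        (concaveOn_comp_dotp l (σ b) (g := id) (t := Set.univ) (convex_Icc _ _)
          (concaveOn_id convex_univ) fun _ _ => Set.mem_univ _) (fun y hy => ?_) x hx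
      · have h4 : x i * ε ≤ 1 * ε := mul_le_mul_of_nonneg_right hi1 hε.le
        simp only [Pi.add_apply, add_sub_cancel_right] at hlx
        linarith
      · refine le_trans ?_ (add_le_add_left (hl y hy) (σ b))
        unfold chordExtension
        split_ifs
        · rw [add_comm b, sub_add_cancel]
        · have h0 : 0 < zhat - b := sub_pos.2 hbz
          have h2 := hw'.le_chord (hrange y hy)
          rw [add_sub_cancel_right] at h2
          rw [← sub_le_iff_le_add, div_mul_eq_mul_div, le_div_iff₀ h0]
          exact h2
    · have h1 := face_le_of_concaveOn hφc hx hi hmax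
      have h2 : σ b ≤ φ 0 := by
        simpa [dotp_zero] using hφm 0 ⟨le_rfl, zero_le_one⟩
      have h3 := mul_le_mul_of_nonneg_left h2 (sub_nonneg.2 hi1)
      have h4 := hψmin (fun y => φ (i.insertNth (1 : ℝ) y) + -σ b)
        ((concaveOn_comp_insertNth i hφc).add_const (-σ b)) (fun y hy => by
          have := hφm _ (insertNth_mem_Icc i hy)
          simp only [dotp_succAbove w _ i, Fin.insertNth_apply_same, Fin.insertNth_apply_succAbove, mul_one] at this
          rw [add_comm (w i)] at this
          exact add_le_add_left this (-σ b)) _ (div_mem_Icc hi hx0 hmax)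
      have h5 := mul_le_mul_of_nonneg_left h4 hi.le
      linarith
end
end

section
/- If a continuous function σ : ℝ → ℝ is convex, concave, or S-shaped, then σ satisfies the STFE property. -/
noncomputable section

/-- A line on the left of `a` and a concave function lying below it on the right of `a`
glue to a concave function. -/
theorem concaveOn_ite_affine {σ : ℝ → ℝ} {ℓ u a c m : ℝ}
    (hau : a ≤ u) (ha : σ a = c + m * (a - ℓ)) (hσ : ConcaveOn ℝ (Set.Icc a u) σ)
    (hle : ∀ z ∈ Set.Icc a u, σ z ≤ c + m * (z - ℓ)) :
    ConcaveOn ℝ (Set.Icc ℓ u) (fun z => if z < a then c + m * (z - ℓ) else σ z) := by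
  refine concaveOn_of_slope_anti_adjacent (convex_Icc ℓ u) ?_
  intro x y z hx hz hxy hyz
  have hxy' : 0 < y - x := sub_pos.2 hxy
  have hyz' : 0 < z - y := sub_pos.2 hyz
  rcases le_or_gt y a with hya | hay
  · have hy : (if y < a then c + m * (y - ℓ) else σ y) = c + m * (y - ℓ) := by
      split_ifs with h
      · rfl
      · rw [le_antisymm hya (not_lt.1 h), ha]
    have hzle : (if z < a then c + m * (z - ℓ) else σ z) ≤ c + m * (z - ℓ) := by
      split_ifs with h
      · exact le_rfl
      · exact hle z ⟨not_lt.1 h, hz.2⟩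
    rw [hy, if_pos (hxy.trans_le hya), div_le_div_iff₀ hyz' hxy']
    nlinarith
  · have hza : a < z := hay.trans hyz
    rw [if_neg hay.not_gt, if_neg hza.not_gt]
    split_ifs with hxa
    · have hslope := hσ.slope_anti_adjacent ⟨le_rfl, hau⟩ ⟨hza.le, hz.2⟩ hay hyz
      have hya' : 0 < y - a := sub_pos.2 hay
      have hyle := hle y ⟨hay.le, hyz.le.trans hz.2⟩
      set k := (σ z - σ y) / (z - y)
      rw [le_div_iff₀ hya'] at hslope
      have hkm : k ≤ m := by
        refine le_of_mul_le_mul_right ?_ hya'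
        linarith
      rw [le_div_iff₀ hxy']
      nlinarith [mul_le_mul_of_nonneg_right hkm (sub_pos.2 hxa).le]
    · exact hσ.slope_anti_adjacent ⟨not_lt.1 hxa, hxy.le.trans (hyz.le.trans hz.2)⟩
        ⟨hza.le, hz.2⟩ hxy hyz

/-- If `σ` is concave on `[a,u]` and lies below the line through `(ℓ, σ ℓ)` and `(a, σ a)`
on `[ℓ,u]`, then `a` is an STFE witness. -/
theorem stfeWitness_of_le_secant {σ : ℝ → ℝ} {ℓ u a : ℝ} (hℓa : ℓ < a) (hau : a ≤ u)
    (hσ : ConcaveOn ℝ (Set.Icc a u) σ)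
    (hle : ∀ z ∈ Set.Icc ℓ u, σ z ≤ σ ℓ + (σ a - σ ℓ) / (a - ℓ) * (z - ℓ)) :
    STFEwitness σ ℓ u a := by
  have hpos : 0 < a - ℓ := sub_pos.2 hℓa
  refine ⟨⟨hℓa.le, hau⟩, ?_, ?_, ?_⟩
  · refine concaveOn_ite_affine hau ?_ hσ fun z hz => hle z ⟨hℓa.le.trans hz.1, hz.2⟩
    field_simp
    ring
  · intro z hz
    dsimp only
    split_ifs
    · exact hle z hz
    · exact le_rfl
  · intro h hh hσh z hz
    dsimp only
    split_ifs with hza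
    · have hℓ : ℓ ∈ Set.Icc ℓ u := ⟨le_rfl, hℓa.le.trans hau⟩
      have ha : a ∈ Set.Icc ℓ u := ⟨hℓa.le, hau⟩
      have hs : 0 ≤ (z - ℓ) / (a - ℓ) := div_nonneg (sub_nonneg.2 hz.1) hpos.le
      have ht : 0 ≤ (a - z) / (a - ℓ) := div_nonneg (sub_nonneg.2 hza.le) hpos.le
      have hsum : (a - z) / (a - ℓ) + (z - ℓ) / (a - ℓ) = 1 := by
        field_simp
        ring
      have hchord := hh.2 hℓ ha ht hs hsum
      have hcomb : (a - z) / (a - ℓ) * ℓ + (z - ℓ) / (a - ℓ) * a = z := by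
        field_simp
        ring
      simp only [smul_eq_mul, hcomb] at hchord
      have hline : σ ℓ + (σ a - σ ℓ) / (a - ℓ) * (z - ℓ)
          = (a - z) / (a - ℓ) * σ ℓ + (z - ℓ) / (a - ℓ) * σ a := by
        field_simp
        ring
      rw [hline]
      linarith [mul_le_mul_of_nonneg_left (hσh ℓ hℓ) ht,
        mul_le_mul_of_nonneg_left (hσh a ha) hs]
    · exact hσh z hz

/-- If `σ` is concave on `[ℓ,u]`, then `ℓ` is an STFE witness. -/
theorem stfeWitness_left_of_concaveOn {σ : ℝ → ℝ} {ℓ u : ℝ} (hℓu : ℓ ≤ u)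
    (hσ : ConcaveOn ℝ (Set.Icc ℓ u) σ) : STFEwitness σ ℓ u ℓ := by
  have heq : Set.EqOn σ
      (fun z => if z < ℓ then σ ℓ + (σ ℓ - σ ℓ) / (ℓ - ℓ) * (z - ℓ) else σ z)
      (Set.Icc ℓ u) := fun z hz => (if_neg hz.1.not_gt).symm
  exact ⟨⟨le_rfl, hℓu⟩, hσ.congr heq, fun z hz => (heq hz).le,
    fun h _ hσh z hz => (heq hz).symm.le.trans (hσh z hz)⟩

/-- A function that is convex on `[ℓ,c]`, and concave and continuous on `[c,u]`, has an STFE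
witness on `[ℓ,u]`. -/
theorem exists_stfeWitness {σ : ℝ → ℝ} {ℓ c u : ℝ} (hσ : ContinuousOn σ (Set.Icc c u))
    (hℓc : ℓ ≤ c) (hcu : c ≤ u) (hconv : ConvexOn ℝ (Set.Icc ℓ c) σ)
    (hconc : ConcaveOn ℝ (Set.Icc c u) σ) : ∃ a, STFEwitness σ ℓ u a := by
  rcases hℓc.eq_or_lt with rfl | hlt
  · exact ⟨ℓ, stfeWitness_left_of_concaveOn hcu hconc⟩
  have hcont : ContinuousOn (fun z => (σ z - σ ℓ) / (z - ℓ)) (Set.Icc c u) :=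
    (hσ.sub continuousOn_const).div (continuousOn_id.sub continuousOn_const)
      fun z hz => (sub_pos.2 (hlt.trans_le hz.1)).ne'
  obtain ⟨a, ha, hmax⟩ := isCompact_Icc.exists_isMaxOn ⟨c, le_rfl, hcu⟩ hcont
  have hsec : ∀ z ∈ Set.Icc c u, (σ z - σ ℓ) / (z - ℓ) ≤ (σ a - σ ℓ) / (a - ℓ) :=
    fun z hz => hmax hz
  refine ⟨a, stfeWitness_of_le_secant (hlt.trans_le ha.1) ha.2
    (hconc.subset (Set.Icc_subset_Icc_left ha.1) (convex_Icc a u)) fun z hz => ?_⟩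
  rcases hz.1.eq_or_lt with rfl | hℓz
  · simp
  have hslope : (σ z - σ ℓ) / (z - ℓ) ≤ (σ a - σ ℓ) / (a - ℓ) := by
    rcases le_total c z with hcz | hzc
    · exact hsec z ⟨hcz, hz.2⟩
    · exact (hconv.secant_mono ⟨le_rfl, hℓc⟩ ⟨hz.1, hzc⟩ ⟨hℓc, le_rfl⟩ hℓz.ne' hlt.ne'
        hzc).trans (hsec c ⟨le_rfl, hcu⟩)
  rw [div_le_iff₀ (sub_pos.2 hℓz)] at hslope
  linarith

/-- A function that is convex on `[ℓ,u]` has an STFE witness on `[ℓ,u]`. -/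
theorem exists_stfeWitness_of_convexOn {σ : ℝ → ℝ} {ℓ u : ℝ}
    (hℓu : ℓ ≤ u) (hconv : ConvexOn ℝ (Set.Icc ℓ u) σ) : ∃ a, STFEwitness σ ℓ u a := by
  refine exists_stfeWitness (by simp) hℓu le_rfl hconv ?_
  rw [Set.Icc_self]
  exact (concaveOn_const (σ u) (convex_singleton u)).congr fun z hz => by
    rw [Set.mem_singleton_iff.1 hz]

theorem stmt1 (σ : ℝ → ℝ) (hσ : Continuous σ)
    (h : ConvexOn ℝ Set.univ σ ∨ ConcaveOn ℝ Set.univ σ ∨ SShaped σ) :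
    STFE σ := by
  intro ℓ u hℓu
  rcases h with h | h | ⟨c, hconv, hconc⟩
  · exact exists_stfeWitness_of_convexOn hℓu
      (h.subset (Set.subset_univ _) (convex_Icc ℓ u))
  · exact ⟨ℓ, stfeWitness_left_of_concaveOn hℓu
      (h.subset (Set.subset_univ _) (convex_Icc ℓ u))⟩
  · rcases le_total c ℓ with hcℓ | hℓc
    · exact ⟨ℓ, stfeWitness_left_of_concaveOn hℓu
        (hconc.subset (fun z hz => hcℓ.trans hz.1) (convex_Icc ℓ u))⟩
    rcases le_total u c with huc | hcu
    · exact exists_stfeWitness_of_convexOn hℓu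
        (hconv.subset (fun z hz => hz.2.trans huc) (convex_Icc ℓ u))
    · exact exists_stfeWitness hσ.continuousOn hℓc hcu
        (hconv.subset (fun z hz => hz.2) (convex_Icc ℓ c))
        (hconc.subset (fun z hz => hz.1) (convex_Icc c u))
end
end

section
/- Let σ : ℝ → ℝ satisfy the STFE property with tie point ẑ on an interval [L,U]. Then for every Ũ ∈ [ẑ, U], conc(σ,[L,Ũ])(z) = conc(σ,[L,U])(z) for all z ∈ [L,Ũ], and ẑ is also the tie point of σ over the interval [L,Ũ]. -/
noncomputable section

theorem IsConcaveEnvelope.eqOn {E : Type*} [AddCommMonoid E] [Module ℝ E]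
    {S : Set E} {f φ ψ : E → ℝ} (hφ : IsConcaveEnvelope S f φ)
    (hψ : IsConcaveEnvelope S f ψ) : Set.EqOn φ ψ S := fun x hx =>
  le_antisymm (hφ.2.2 ψ hψ.1 hψ.2.1 x hx) (hψ.2.2 φ hφ.1 hφ.2.1 x hx)

theorem IsConcaveEnvelope.congr {E : Type*} [AddCommMonoid E] [Module ℝ E]
    {S : Set E} {f φ ψ : E → ℝ} (hφ : IsConcaveEnvelope S f φ)
    (h : Set.EqOn φ ψ S) : IsConcaveEnvelope S f ψ :=
  ⟨hφ.1.congr h, fun x hx => (hφ.2.1 x hx).trans_eq (h hx),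
    fun k hk hfk x hx => (h hx).symm.trans_le (hφ.2.2 k hk hfk x hx)⟩

/-- A secant of a function majorized at its endpoints by a concave function lies below it. -/
theorem ConcaveOn.secant_le {S : Set ℝ} {f h : ℝ → ℝ} (hh : ConcaveOn ℝ S h) {a b x : ℝ}
    (ha : a ∈ S) (hb : b ∈ S) (hfa : f a ≤ h a) (hfb : f b ≤ h b) (hax : a ≤ x) (hxb : x < b) :
    f a + (f b - f a) / (b - a) * (x - a) ≤ h x := by
  have hab : 0 < b - a := by linarith
  have hs : 0 ≤ (b - x) / (b - a) := div_nonneg (by linarith) hab.le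
  have ht : 0 ≤ (x - a) / (b - a) := div_nonneg (by linarith) hab.le
  have hconc := hh.2 ha hb hs ht (by field_simp; ring)
  have hx : ((b - x) / (b - a)) • a + ((x - a) / (b - a)) • b = x := by
    simp only [smul_eq_mul]; field_simp; ring
  rw [hx] at hconc
  simp only [smul_eq_mul] at hconc
  calc f a + (f b - f a) / (b - a) * (x - a)
      = (b - x) / (b - a) * f a + (x - a) / (b - a) * f b := by field_simp; ring
    _ ≤ (b - x) / (b - a) * h a + (x - a) / (b - a) * h b := by gcongr
    _ ≤ h x := hconc

/-- An STFE witness remains one when the right endpoint is lowered, but not below the witness. -/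
theorem STFEwitness.mono_right {σ : ℝ → ℝ} {ℓ u v z : ℝ} (hz : STFEwitness σ ℓ u z)
    (hzv : z ≤ v) (hvu : v ≤ u) : STFEwitness σ ℓ v z := by
  obtain ⟨⟨hℓz, -⟩, hconc, hmaj, -⟩ := hz
  have hsub : Set.Icc ℓ v ⊆ Set.Icc ℓ u := Set.Icc_subset_Icc_right hvu
  refine ⟨⟨hℓz, hzv⟩, hconc.subset hsub (convex_Icc ℓ v), fun x hx => hmaj x (hsub hx),
    fun h hh hσh x hx => ?_⟩
  have hℓ : ℓ ∈ Set.Icc ℓ v := ⟨le_rfl, hℓz.trans hzv⟩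
  have hz : z ∈ Set.Icc ℓ v := ⟨hℓz, hzv⟩
  dsimp only
  split_ifs with hxz
  · exact hh.secant_le hℓ hz (hσh ℓ hℓ) (hσh z hz) hx.1 hxz
  · exact hσh x hx

theorem stmt2 (σ : ℝ → ℝ) (hσ : Continuous σ) (hSTFE : STFE σ)
    (L U zhat : ℝ) (hLU : L ≤ U) (htie : IsTiePoint σ L U zhat)
    (Ut : ℝ) (hUt : Ut ∈ Set.Icc zhat U)
    (φ ψ : ℝ → ℝ)
    (hφ : IsConcaveEnvelope (Set.Icc L U) σ φ)
    (hψ : IsConcaveEnvelope (Set.Icc L Ut) σ ψ) :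
    (∀ z ∈ Set.Icc L Ut, ψ z = φ z) ∧ IsTiePoint σ L Ut zhat := by
  obtain ⟨hwit, hmin⟩ := htie
  have hwit' := hwit.mono_right hUt.1 hUt.2
  refine ⟨fun z hz => (hψ.eqOn hwit'.2 hz).trans
    (hwit.2.eqOn hφ ⟨hz.1, hz.2.trans hUt.2⟩), hwit', fun z hz => ?_⟩
  refine hmin z ⟨⟨hz.1.1, hz.1.2.trans hUt.2⟩, hwit.2.congr fun x hx => ?_⟩
  rcases le_total x Ut with hxU | hxU
  · exact hwit'.2.eqOn hz.2 ⟨hx.1, hxU⟩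
  · simp only [if_neg (hUt.1.trans hxU).not_gt, if_neg (hz.1.2.trans hxU).not_gt]
end
end

section
/- Let σ : ℝ → ℝ satisfy the STFE property with tie point ẑ on an interval [L,U], and suppose L < ẑ. Then for every Ũ ∈ (L, ẑ], the concave envelope of σ over [L,Ũ] is the secant over the whole interval: conc(σ,[L,Ũ])(z) = σ(L) + ((σ(Ũ)−σ(L))/(Ũ−L))·(z−L) for all z ∈ [L,Ũ]. -/
noncomputable section

/-- The secant of `σ` from `ℓ` to `s`, followed by `σ` itself. -/
def secantThen (σ : ℝ → ℝ) (ℓ s z : ℝ) : ℝ :=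
  if z < s then σ ℓ + (σ s - σ ℓ) / (s - ℓ) * (z - ℓ) else σ z

theorem secantThen_eq_add {σ : ℝ → ℝ} {ℓ s z : ℝ} (hs : ℓ < s) (hz : z ≤ s) :
    secantThen σ ℓ s z = σ ℓ + (σ s - σ ℓ) / (s - ℓ) * (z - ℓ) := by
  rcases hz.lt_or_eq with h | rfl
  · exact if_pos h
  · have : z - ℓ ≠ 0 := (sub_pos.2 hs).ne'
    rw [secantThen, if_neg (lt_irrefl z)]
    field_simp
    ring

theorem secantThen_eq_self {σ : ℝ → ℝ} {ℓ s z : ℝ} (hz : s ≤ z) :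
    secantThen σ ℓ s z = σ z :=
  if_neg hz.not_gt

theorem continuous_secantThen {σ : ℝ → ℝ} (hσ : Continuous σ) {ℓ s : ℝ} (hs : ℓ ≤ s) :
    Continuous (secantThen σ ℓ s) := by
  have : secantThen σ ℓ s =
      fun z => if s ≤ z then σ z else σ ℓ + (σ s - σ ℓ) / (s - ℓ) * (z - ℓ) := by
    funext z
    by_cases h : s ≤ z
    · simp [secantThen, h]
    · simp [secantThen, h, not_le.1 h]
  rw [this]
  refine Continuous.if_le hσ (by fun_prop) continuous_const continuous_id ?_
  rintro z rfl
  rcases hs.lt_or_eq with h | rfl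
  · have : s - ℓ ≠ 0 := (sub_pos.2 h).ne'
    field_simp
    ring
  · simp

theorem STFEwitness.isConcaveEnvelope {σ : ℝ → ℝ} {ℓ u s : ℝ} (h : STFEwitness σ ℓ u s) :
    IsConcaveEnvelope (Set.Icc ℓ u) σ (secantThen σ ℓ s) :=
  h.2

/-- Minimality is automatic: a concave majorant lies above the secant. -/
theorem STFEwitness.of_concaveOn {σ : ℝ → ℝ} {ℓ u s : ℝ} (hs : s ∈ Set.Icc ℓ u)
    (hc : ConcaveOn ℝ (Set.Icc ℓ u) (secantThen σ ℓ s))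
    (hm : ∀ z ∈ Set.Icc ℓ u, σ z ≤ secantThen σ ℓ s z) : STFEwitness σ ℓ u s := by
  refine ⟨hs, hc, hm, fun h hh hσh z hz => ?_⟩
  change secantThen σ ℓ s z ≤ h z
  rcases le_or_gt s z with hsz | hzs
  · rw [secantThen_eq_self hsz]
    exact hσh z hz
  · have hℓs : ℓ < s := hz.1.trans_lt hzs
    have hpos : 0 < s - ℓ := sub_pos.2 hℓs
    have hℓ : ℓ ∈ Set.Icc ℓ u := ⟨le_rfl, hz.1.trans hz.2⟩
    have key := hh.2 hℓ hs (div_nonneg (sub_nonneg.2 hzs.le) hpos.le)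
      (div_nonneg (sub_nonneg.2 hz.1) hpos.le) (by field_simp; ring)
    have hz' : ((s - z) / (s - ℓ)) • ℓ + ((z - ℓ) / (s - ℓ)) • s = z := by
      simp only [smul_eq_mul]
      field_simp
      ring
    rw [hz'] at key
    refine le_trans ?_ key
    rw [secantThen_eq_add hℓs hzs.le]
    simp only [smul_eq_mul]
    have h₁ := mul_le_mul_of_nonneg_left (hσh ℓ hℓ)
      (div_nonneg (sub_nonneg.2 hzs.le) hpos.le)
    have h₂ := mul_le_mul_of_nonneg_left (hσh s hs)
      (div_nonneg (sub_nonneg.2 hz.1) hpos.le)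
    refine le_trans (le_of_eq ?_) (add_le_add h₁ h₂)
    field_simp
    ring

theorem STFEwitness.restrict {σ : ℝ → ℝ} {ℓ u v s : ℝ} (h : STFEwitness σ ℓ u s)
    (hsv : s ≤ v) (hvu : v ≤ u) : STFEwitness σ ℓ v s := by
  have hsub : Set.Icc ℓ v ⊆ Set.Icc ℓ u := Set.Icc_subset_Icc_right hvu
  exact .of_concaveOn ⟨h.1.1, hsv⟩ (h.isConcaveEnvelope.1.subset hsub (convex_Icc _ _))
    fun z hz => h.isConcaveEnvelope.2.1 z (hsub hz)

/-- A witness on a shorter interval reaching past a witness of the longer interval is a witness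
on the longer interval. -/
theorem STFEwitness.extend {σ : ℝ → ℝ} {ℓ u v s t : ℝ} (ht : STFEwitness σ ℓ v t)
    (hs : STFEwitness σ ℓ u s) (hsv : s ≤ v) (hvu : v ≤ u) : STFEwitness σ ℓ u t := by
  refine ⟨⟨ht.1.1, ht.1.2.trans hvu⟩, hs.isConcaveEnvelope.congr fun z hz => ?_⟩
  change secantThen σ ℓ s z = secantThen σ ℓ t z
  rcases le_total z v with hzv | hvz
  · exact (hs.restrict hsv hvu).isConcaveEnvelope.eqOn ht.isConcaveEnvelope ⟨hz.1, hzv⟩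
  · rw [secantThen_eq_self (hsv.trans hvz), secantThen_eq_self (ht.1.2.trans hvz)]

theorem STFEwitness.cross_le {σ : ℝ → ℝ} {ℓ u s z : ℝ} (h : STFEwitness σ ℓ u s)
    (hℓs : ℓ < s) (hz : z ∈ Set.Icc ℓ s) :
    (σ z - σ ℓ) * (s - ℓ) ≤ (σ s - σ ℓ) * (z - ℓ) := by
  have key := h.isConcaveEnvelope.2.1 z ⟨hz.1, hz.2.trans h.1.2⟩
  rw [secantThen_eq_add hℓs hz.2, ← sub_le_iff_le_add', div_mul_eq_mul_div,
    le_div_iff₀ (sub_pos.2 hℓs)] at key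
  exact key

theorem STFEwitness.of_cross_le {σ : ℝ → ℝ} {ℓ u : ℝ} (hℓu : ℓ < u)
    (h : ∀ z ∈ Set.Icc ℓ u, (σ z - σ ℓ) * (u - ℓ) ≤ (σ u - σ ℓ) * (z - ℓ)) :
    STFEwitness σ ℓ u u := by
  refine .of_concaveOn ⟨hℓu.le, le_rfl⟩ ?_ fun z hz => ?_
  · refine ConcaveOn.congr (f := fun z => σ ℓ + (σ u - σ ℓ) / (u - ℓ) * (z - ℓ)) ?_
      fun z hz => (secantThen_eq_add hℓu hz.2).symm
    refine ⟨convex_Icc _ _, fun x _ y _ a b _ _ hab => le_of_eq ?_⟩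
    obtain rfl : b = 1 - a := by linarith
    simp only [smul_eq_mul]
    ring
  · rw [secantThen_eq_add hℓu hz.2, ← sub_le_iff_le_add', div_mul_eq_mul_div,
      le_div_iff₀ (sub_pos.2 hℓu)]
    exact h z hz

theorem concaveOn_Icc_of_forall_lt {f : ℝ → ℝ} (hf : Continuous f) {ℓ u : ℝ} (hℓu : ℓ < u)
    (h : ∀ v, ℓ < v → v < u → ConcaveOn ℝ (Set.Icc ℓ v) f) : ConcaveOn ℝ (Set.Icc ℓ u) f := by
  refine ⟨convex_Icc _ _, fun x hx y hy a b ha hb hab => ?_⟩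
  have hclosed : IsClosed {v : ℝ | a • f (min x v) + b • f (min y v) ≤
      f (a • min x v + b • min y v)} := isClosed_le (by fun_prop) (by fun_prop)
  have hsub : Set.Ioo ℓ u ⊆ {v : ℝ | a • f (min x v) + b • f (min y v) ≤
      f (a • min x v + b • min y v)} := fun v hv =>
    (h v hv.1 hv.2).2 ⟨le_min hx.1 hv.1.le, min_le_right _ _⟩
      ⟨le_min hy.1 hv.1.le, min_le_right _ _⟩ ha hb hab
  have hu := hclosed.closure_subset_iff.2 hsub
    (by rw [closure_Ioo hℓu.ne]; exact ⟨hℓu.le, le_rfl⟩ : u ∈ closure (Set.Ioo ℓ u))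
  simpa only [Set.mem_ofPred_eq, min_eq_left hx.2, min_eq_left hy.2] using hu

theorem STFEwitness.of_forall_lt {σ : ℝ → ℝ} (hσ : Continuous σ) {ℓ u t : ℝ} (hℓt : ℓ ≤ t)
    (htu : t < u) (h : ∀ v, t < v → v < u → STFEwitness σ ℓ v t) : STFEwitness σ ℓ u t := by
  refine .of_concaveOn ⟨hℓt, htu.le⟩ ?_ fun z hz => ?_
  · refine concaveOn_Icc_of_forall_lt (continuous_secantThen hσ hℓt) (hℓt.trans_lt htu)
      fun v hv hvu => ?_
    have hlt : max v ((t + u) / 2) < u := max_lt hvu (by linarith)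
    have htlt : t < max v ((t + u) / 2) := lt_max_of_lt_right (by linarith)
    exact (h _ htlt hlt).isConcaveEnvelope.1.subset
      (Set.Icc_subset_Icc_right (le_max_left _ _)) (convex_Icc _ _)
  · rcases le_or_gt t z with htz | hzt
    · exact (secantThen_eq_self htz).ge
    · exact (h ((t + u) / 2) (by linarith) (by linarith)).isConcaveEnvelope.2.1 z
        ⟨hz.1, by linarith⟩

/-- There is a largest right endpoint in `[v, w]` for which `t` is a witness. -/
theorem exists_isGreatest_STFEwitness {σ : ℝ → ℝ} (hσ : Continuous σ) {ℓ v w t : ℝ}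
    (htv : t < v) (hvw : v ≤ w) (ht : STFEwitness σ ℓ v t) :
    ∃ u, IsGreatest {u | u ∈ Set.Icc v w ∧ STFEwitness σ ℓ u t} u := by
  set A := {u | u ∈ Set.Icc v w ∧ STFEwitness σ ℓ u t}
  have hv : v ∈ A := ⟨⟨le_rfl, hvw⟩, ht⟩
  have hbdd : BddAbove A := ⟨w, fun u hu => hu.1.2⟩
  have hvs : v ≤ sSup A := le_csSup hbdd hv
  refine ⟨sSup A, ⟨⟨hvs, csSup_le ⟨v, hv⟩ fun u hu => hu.1.2⟩, ?_⟩, fun u hu => le_csSup hbdd hu⟩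
  refine .of_forall_lt hσ ht.1.1 (htv.trans_le hvs) fun x htx hx => ?_
  obtain ⟨y, hy, hxy⟩ := exists_lt_of_lt_csSup ⟨v, hv⟩ hx
  exact hy.2.restrict htx.le hxy.le

theorem STFEwitness.self_of_forall_gt {σ : ℝ → ℝ} (hσ : Continuous σ) {ℓ u w : ℝ}
    (hℓu : ℓ < u) (huw : u < w)
    (h : ∀ v, u < v → v ≤ w → ∃ s, u < s ∧ STFEwitness σ ℓ v s) : STFEwitness σ ℓ u u := by
  refine .of_cross_le hℓu fun z hz => ?_
  by_contra! hlt
  have hopen : IsOpen {s : ℝ | (σ s - σ ℓ) * (z - ℓ) < (σ z - σ ℓ) * (s - ℓ)} :=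
    isOpen_lt (by fun_prop) (by fun_prop)
  obtain ⟨ε, hε, hball⟩ := Metric.isOpen_iff.1 hopen u hlt
  obtain ⟨s, hus, hs⟩ := h (min (u + ε / 2) w) (lt_min (by linarith) huw) (min_le_right _ _)
  have hsε : s ≤ u + ε / 2 := hs.1.2.trans (min_le_left _ _)
  have hmem : s ∈ Metric.ball u ε := by
    rw [Real.ball_eq_Ioo]
    exact ⟨by linarith, by linarith⟩
  exact (hs.cross_le (hℓu.trans hus) ⟨hz.1, hz.2.trans hus.le⟩).not_gt (hball hmem)

theorem IsTiePoint.STFEwitness_self {σ : ℝ → ℝ} (hσ : Continuous σ) (hSTFE : STFE σ)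
    {ℓ u s v : ℝ} (hs : IsTiePoint σ ℓ u s) (hv : v ∈ Set.Ioc ℓ s) : STFEwitness σ ℓ v v := by
  obtain ⟨t, ht⟩ := hSTFE ℓ v hv.1.le
  rcases ht.1.2.eq_or_lt with rfl | htv
  · exact ht
  obtain ⟨w, ⟨⟨hvw, hws⟩, hw⟩, hmax⟩ := exists_isGreatest_STFEwitness hσ htv hv.2 ht
  have hℓw : ℓ < w := hv.1.trans_le hvw
  rcases hws.eq_or_lt with rfl | hws
  · exact absurd (hs.2 t (hw.extend hs.1 le_rfl hs.1.1.2)) (htv.trans_le hvw).not_ge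
  have hself : STFEwitness σ ℓ w w := by
    refine .self_of_forall_gt hσ hℓw hws fun x hwx hxs => ?_
    obtain ⟨r, hr⟩ := hSTFE ℓ x (hℓw.trans hwx).le
    refine ⟨r, lt_of_not_ge fun hrw => ?_, hr⟩
    exact (hmax ⟨⟨hvw.trans hwx.le, hxs⟩, hw.extend hr hrw hwx.le⟩).not_gt hwx
  have hval := hself.isConcaveEnvelope.eqOn hw.isConcaveEnvelope ⟨hv.1.le, hvw⟩
  rw [secantThen_eq_add hℓw hvw, secantThen_eq_self htv.le] at hval
  refine .of_cross_le hv.1 fun z hz => ?_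
  have hz' := hself.isConcaveEnvelope.2.1 z ⟨hz.1, hz.2.trans hvw⟩
  rw [secantThen_eq_add hℓw (hz.2.trans hvw)] at hz'
  calc (σ z - σ ℓ) * (v - ℓ) ≤ (σ w - σ ℓ) / (w - ℓ) * (z - ℓ) * (v - ℓ) :=
        mul_le_mul_of_nonneg_right (by linarith) (sub_nonneg.2 hv.1.le)
    _ = (σ v - σ ℓ) * (z - ℓ) := by rw [← hval]; ring

theorem stmt3 (σ : ℝ → ℝ) (hσ : Continuous σ) (hSTFE : STFE σ)
    (L U zhat : ℝ) (hLU : L ≤ U) (htie : IsTiePoint σ L U zhat) (hLz : L < zhat)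
    (Ut : ℝ) (hUt : Ut ∈ Set.Ioc L zhat)
    (ψ : ℝ → ℝ) (hψ : IsConcaveEnvelope (Set.Icc L Ut) σ ψ) :
    ∀ z ∈ Set.Icc L Ut, ψ z = σ L + (σ Ut - σ L) / (Ut - L) * (z - L) := by
  intro z hz
  have h := htie.STFEwitness_self hσ hSTFE hUt
  rw [hψ.eqOn h.isConcaveEnvelope hz, secantThen_eq_add hUt.1 hz.2]
end
end

section
/- Let σ : ℝ → ℝ satisfy the STFE property with tie point ẑ on an interval [L,U]. Then for any L̃ ∈ [L, ẑ], the tie point z̃ of σ over the interval [L̃, U] satisfies z̃ ≤ ẑ. -/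
noncomputable section

/-- The concave envelope over a smaller convex set lies below the one over a larger set. -/
theorem IsConcaveEnvelope.le_of_subset {E : Type*} [AddCommMonoid E] [Module ℝ E]
    {S T : Set E} {f φ ψ : E → ℝ} (hψ : IsConcaveEnvelope T f ψ)
    (hφ : IsConcaveEnvelope S f φ) (hT : Convex ℝ T) (hTS : T ⊆ S) {x : E} (hx : x ∈ T) :
    ψ x ≤ φ x :=
  hψ.2.2 φ (hφ.1.subset hTS hT) (fun y hy => hφ.2.1 y (hTS hy)) x hx

theorem stmt4 (σ : ℝ → ℝ) (hσ : Continuous σ) (hSTFE : STFE σ)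
    (L U zhat : ℝ) (hLU : L ≤ U) (htie : IsTiePoint σ L U zhat)
    (Lt : ℝ) (hLt : Lt ∈ Set.Icc L zhat)
    (ztil : ℝ) (htie' : IsTiePoint σ Lt U ztil) :
    ztil ≤ zhat := by
  by_contra! hlt
  obtain ⟨⟨⟨-, hzU⟩, hφ⟩, -⟩ := htie
  obtain ⟨⟨-, hψ⟩, hmin⟩ := htie'
  refine absurd (hmin zhat ⟨⟨hLt.2, hzU⟩, hψ.congr ?_⟩) (not_le.2 hlt)
  -- Past `zhat`, the envelope over `[Lt, U]` is squeezed between `σ` and `σ`.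
  have key : ∀ z ∈ Set.Icc zhat U,
      (if z < ztil then σ Lt + (σ ztil - σ Lt) / (ztil - Lt) * (z - Lt) else σ z) = σ z := by
    intro z hz
    have hz' : z ∈ Set.Icc Lt U := ⟨hLt.2.trans hz.1, hz.2⟩
    refine le_antisymm ?_ (hψ.2.1 z hz')
    have hle := hψ.le_of_subset hφ (convex_Icc Lt U) (Set.Icc_subset_Icc_left hLt.1) hz'
    simpa only [if_neg (not_lt.2 hz.1)] using hle
  intro z hz
  beta_reduce
  by_cases h : z < zhat
  · rw [if_pos h, if_pos (h.trans hlt)]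
    have hsecant := key zhat ⟨le_rfl, hzU⟩
    rw [if_pos hlt] at hsecant
    have hne : zhat - Lt ≠ 0 := (sub_pos.2 (hz.1.trans_lt h)).ne'
    rw [← hsecant, add_sub_cancel_left, mul_div_cancel_right₀ _ hne]
  · rw [if_neg h]
    exact key z ⟨not_lt.1 h, hz.2⟩
end
end

section
/- Let D ⊆ ℝ^n be a convex set and D′ a non-empty face of D. If φ(x) is the concave envelope of f(x) over D, then the restriction of φ to D′ is the concave envelope of f over D′. -/
noncomputable section

/-- Lowering a concave function on a face to its minimum with another concave function
preserves concavity. -/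
theorem IsFace.concaveOn_piecewise_min {E : Type*} [AddCommGroup E] [Module ℝ E]
    {D D' : Set E} (hface : IsFace D D') {φ h : E → ℝ} [DecidablePred (· ∈ D')]
    (hφ : ConcaveOn ℝ D φ) (hh : ConcaveOn ℝ D' h) :
    ConcaveOn ℝ D (D'.piecewise (φ ⊓ h) φ) := by
  have hle : ∀ x, D'.piecewise (φ ⊓ h) φ x ≤ φ x := fun x => by
    by_cases hx : x ∈ D' <;> simp [hx]
  have hmin : ConcaveOn ℝ D' (φ ⊓ h) := (hφ.subset hface.1 hface.2.1).inf hh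
  refine concaveOn_iff_forall_pos.2 ⟨hφ.1, fun x hx y hy a b ha hb hab => ?_⟩
  by_cases hz : a • x + b • y ∈ D'
  · obtain ⟨hx', hy'⟩ := hface.2.2 x hx y hy b hb (by linarith)
      (by rwa [← eq_sub_of_add_eq hab])
    simpa only [Set.piecewise_eq_of_mem _ _ _ hx', Set.piecewise_eq_of_mem _ _ _ hy',
      Set.piecewise_eq_of_mem _ _ _ hz] using hmin.2 hx' hy' ha.le hb.le hab
  · rw [Set.piecewise_eq_of_notMem _ _ _ hz]
    refine le_trans ?_ (hφ.2 hx hy ha.le hb.le hab)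
    exact add_le_add (smul_le_smul_of_nonneg_left (hle x) ha.le)
      (smul_le_smul_of_nonneg_left (hle y) hb.le)

theorem stmt5 {n : ℕ} (D D' : Set (Fin n → ℝ)) (hD : Convex ℝ D)
    (hface : IsFace D D') (hne : D'.Nonempty)
    (f φ : (Fin n → ℝ) → ℝ) (hφ : IsConcaveEnvelope D f φ) :
    IsConcaveEnvelope D' f φ := by
  classical
  obtain ⟨hconc, hmaj, hleast⟩ := hφ
  refine ⟨hconc.subset hface.1 hface.2.1, fun x hx => hmaj x (hface.1 hx),
    fun h hh hfh x hx => ?_⟩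
  have hle := hleast _ (hface.concaveOn_piecewise_min hconc hh) (fun y hy => by
    by_cases hy' : y ∈ D'
    · simpa [hy'] using ⟨hmaj y hy, hfh y hy'⟩
    · simpa [hy'] using hmaj y hy) x (hface.1 hx)
  rw [Set.piecewise_eq_of_mem _ _ _ hx] at hle
  exact hle.trans inf_le_right
end
end

section
/- Let w ∈ ℝ^n have all entries strictly positive, b ∈ ℝ, σ : ℝ → ℝ continuous satisfying the STFE property, and f(x) = σ(wᵀx + b) on [0,1]^n. Then the function h : [0,1]^n → ℝ defined by h(x) = f(x) if x ∈ R_f and h(x) = σ(b) + ((σ(ẑ)−σ(b))/(ẑ−b))·wᵀx otherwise, where ẑ is the tie point of σ over [b, wᵀ𝟏 + b] and R_f = {x ∈ [0,1]^n : wᵀx + b ≥ ẑ}, is concave on [0,1]^n and satisfies h(x) ≥ f(x) for all x ∈ [0,1]^n. -/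
noncomputable section

theorem dotp_add_smul {n : ℕ} (w x y : Fin n → ℝ) (s t : ℝ) :
    dotp w (s • x + t • y) = s * dotp w x + t * dotp w y := by
  simp only [dotp, Pi.add_apply, Pi.smul_apply, smul_eq_mul, Finset.mul_sum,
    ← Finset.sum_add_distrib]
  exact Finset.sum_congr rfl fun i _ => by ring

theorem dotp_add_mem_Icc {n : ℕ} {w : Fin n → ℝ} (hw : ∀ i, 0 ≤ w i) (b : ℝ)
    {x : Fin n → ℝ} (hx : x ∈ Set.Icc (0 : Fin n → ℝ) 1) :
    dotp w x + b ∈ Set.Icc b ((∑ i, w i) + b) := by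
  have h0 : 0 ≤ dotp w x := Finset.sum_nonneg fun i _ => mul_nonneg (hw i) (hx.1 i)
  have h1 : dotp w x ≤ ∑ i, w i :=
    Finset.sum_le_sum fun i _ => mul_le_of_le_one_right (hw i) (hx.2 i)
  exact ⟨by linarith, by linarith⟩

theorem ConcaveOn.comp_dotp_add {n : ℕ} {w : Fin n → ℝ} (hw : ∀ i, 0 ≤ w i) {b : ℝ}
    {φ : ℝ → ℝ} (hφ : ConcaveOn ℝ (Set.Icc b ((∑ i, w i) + b)) φ) :
    ConcaveOn ℝ (Set.Icc (0 : Fin n → ℝ) 1) fun x => φ (dotp w x + b) := by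
  refine ⟨convex_Icc 0 1, fun x hx y hy s t hs ht hst => ?_⟩
  have key : dotp w (s • x + t • y) + b = s • (dotp w x + b) + t • (dotp w y + b) := by
    rw [dotp_add_smul, smul_eq_mul, smul_eq_mul]
    linear_combination (-b) * hst
  simp only [key]
  exact hφ.2 (dotp_add_mem_Icc hw b hx) (dotp_add_mem_Icc hw b hy) hs ht hst

theorem stmt6 {n : ℕ} (w : Fin n → ℝ) (hw : ∀ i, 0 < w i) (b : ℝ)
    (σ : ℝ → ℝ) (hσ : Continuous σ) (hSTFE : STFE σ)
    (zhat : ℝ) (htie : IsTiePoint σ b ((∑ i, w i) + b) zhat)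
    (h : (Fin n → ℝ) → ℝ)
    (hh : ∀ x, h x = if zhat ≤ dotp w x + b then σ (dotp w x + b)
      else σ b + (σ zhat - σ b) / (zhat - b) * dotp w x) :
    ConcaveOn ℝ (Set.Icc (0 : Fin n → ℝ) 1) h ∧
      ∀ x ∈ Set.Icc (0 : Fin n → ℝ) 1, σ (dotp w x + b) ≤ h x := by
  obtain ⟨-, hconc, hmaj, -⟩ := htie.1
  have hw' : ∀ i, 0 ≤ w i := fun i => (hw i).le
  have hcomp : h = fun x => (fun z => if z < zhat then
      σ b + (σ zhat - σ b) / (zhat - b) * (z - b) else σ z) (dotp w x + b) := by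
    funext x
    rw [hh]
    by_cases hx : zhat ≤ dotp w x + b
    · simp [hx, not_lt.mpr hx]
    · simp [hx, not_le.mp hx]
  rw [hcomp]
  exact ⟨hconc.comp_dotp_add hw', fun x hx => hmaj _ (dotp_add_mem_Icc hw' b hx)⟩
end
end

section
/- Let w ∈ ℝ^n have all entries strictly positive, b ∈ ℝ, and ẑ ∈ ℝ, and define the region R_i as in the regional subdivision of [0,1]^n. If R_i ≠ ∅, then the i-th canonical vector e_i belongs to R_i; in particular, w_i + b < ẑ. -/
noncomputable section

/-- The sup norm of a nonnegative vector `x` is its `i`-th entry whenever that entry is maximal. -/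
theorem norm_eq_apply_of_forall_le {n : ℕ} {x : Fin n → ℝ} {i : Fin n}
    (h0 : 0 ≤ x) (hmax : ∀ j, x j ≤ x i) : ‖x‖ = x i := by
  refine le_antisymm ((pi_norm_le_iff_of_nonneg (h0 i)).2 fun j => ?_) ?_
  · rw [Real.norm_of_nonneg (h0 j)]
    exact hmax j
  · exact (le_abs_self _).trans (norm_le_pi_norm x i)

theorem stmt9 {n : ℕ} (w : Fin n → ℝ) (hw : ∀ i, 0 < w i) (b zhat : ℝ)
    (i : Fin n) (hne : (Ri w b zhat i).Nonempty) :
    Pi.single i (1 : ℝ) ∈ Ri w b zhat i ∧ w i + b < zhat := by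
  obtain ⟨x, ⟨h0, -⟩, hlt, hl, hr⟩ := hne
  have hmax : ∀ j, x j ≤ x i := fun j =>
    (lt_or_ge j i).elim (fun h => (hl j h).le) (hr j)
  rw [norm_eq_apply_of_forall_le h0 hmax] at hlt
  have hle : w i * x i ≤ dotp w x :=
    Finset.single_le_sum (f := fun j => w j * x j)
      (fun j _ => mul_nonneg (hw j).le (h0 j)) (Finset.mem_univ i)
  have hi : w i + b < zhat :=
    lt_of_mul_lt_mul_right (by linarith : (w i + b) * x i < zhat * x i) (h0 i)
  refine ⟨⟨⟨?_, ?_⟩, ?_, ?_, ?_⟩, hi⟩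
  · exact Pi.single_nonneg.2 zero_le_one
  · intro j
    by_cases h : j = i
    · subst h; simp
    · simp [h]
  · have hd : dotp w (Pi.single i 1) = w i := by simp [dotp, Pi.single_apply]
    rw [hd, Pi.norm_single]
    simpa using hi
  · intro j hj
    simp [hj.ne]
  · intro j _
    by_cases h : j = i
    · subst h; simp
    · simp [h]
end
end

section
/- Let w ∈ ℝ^n have all entries strictly positive, b ∈ ℝ, σ : ℝ → ℝ continuous satisfying the STFE property, f(x) = σ(wᵀx + b) on [0,1]^n, and let ẑ be the tie point of σ over [b, wᵀ𝟏 + b]. Suppose R_i ≠ ∅ (region defined with this ẑ). Then conc(f_{−i},[0,1]^{n−1})(x_{−i}) = conc(f_{−i}, [0,1]^{n−1} ∩ {x_{−i} : w_{−i}ᵀx_{−i} + w_i + b ≤ ẑ})(x_{−i}) for all x_{−i} ∈ [0,1]^{n−1} with w_{−i}ᵀx_{−i} + w_i + b ≤ ẑ. -/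
noncomputable section

/-- Gluing along a hyperplane: a concave function on the part of a convex set below a level of a
linear functional, dominated by a concave function on the whole set and agreeing with it on the
level itself, extends by the dominating function to a concave function on the whole set. -/
theorem ConcaveOn.ite_lt_of_le {E : Type*} [AddCommGroup E] [Module ℝ E] {s : Set E}
    {A : E →ₗ[ℝ] ℝ} {z : ℝ} {ψ G : E → ℝ}
    (hψ : ConcaveOn ℝ (s ∩ {y | A y ≤ z}) ψ) (hG : ConcaveOn ℝ s G)
    (hle : ∀ y ∈ s, A y ≤ z → ψ y ≤ G y) (heq : ∀ y ∈ s, A y = z → ψ y = G y) :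
    ConcaveOn ℝ s (fun y => if A y < z then ψ y else G y) := by
  have h_le_G : ∀ y ∈ s, (if A y < z then ψ y else G y) ≤ G y := by
    intro y hy
    split_ifs with h
    · exact hle y hy h.le
    · exact le_rfl
  have mixed : ∀ x ∈ s, ∀ y ∈ s, A x < z → z ≤ A y → ∀ α β : ℝ, 0 ≤ α → 0 ≤ β → α + β = 1 →
      A (α • x + β • y) < z → α * ψ x + β * G y ≤ ψ (α • x + β • y) := by
    intro x hx y hy hxz hyz α β hα hβ hαβ hq
    have hd : 0 < A y - A x := by linarith
    obtain ⟨t, ht⟩ : ∃ t, t = (z - A x) / (A y - A x) := ⟨_, rfl⟩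
    have ht0 : 0 < t := ht ▸ div_pos (by linarith) hd
    have ht1 : t ≤ 1 := by rw [ht, div_le_one hd]; linarith
    have htz : t * (A y - A x) = z - A x := by rw [ht]; field_simp
    obtain rfl : α = 1 - β := by linarith
    have hβt : β ≤ t := by
      simp only [map_add, map_smul, smul_eq_mul] at hq
      rw [ht, le_div_iff₀ hd]
      linarith
    have hp : (1 - t) • x + t • y ∈ s :=
      hG.1 hx hy (by linarith) ht0.le (by ring)
    have hAp : A ((1 - t) • x + t • y) = z := by
      simp only [map_add, map_smul, smul_eq_mul]
      linarith
    have hGp := hG.2 hx hy (sub_nonneg.2 ht1) ht0.le (by ring)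
    have hr0 : 0 ≤ β / t := div_nonneg hβ ht0.le
    have hr1 : β / t ≤ 1 := (div_le_one ht0).2 hβt
    have hrt : β / t * t = β := by field_simp
    have hψq := hψ.2 ⟨hx, hxz.le⟩ ⟨hp, hAp.le⟩ (sub_nonneg.2 hr1) hr0 (by ring)
    have hcomb : (1 - β / t) • x + (β / t) • ((1 - t) • x + t • y) = (1 - β) • x + β • y := by
      rw [smul_add, smul_smul, smul_smul, hrt, ← add_assoc, ← add_smul]
      congr 2
      linear_combination -hrt
    rw [hcomb, heq _ hp hAp] at hψq
    simp only [smul_eq_mul] at hψq hGp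
    have hlex := hle x hx hxz.le
    have hGp' : (1 - t) * ψ x + t * G y ≤ G ((1 - t) • x + t • y) :=
      (add_le_add_left (mul_le_mul_of_nonneg_left hlex (sub_nonneg.2 ht1)) _).trans hGp
    have := mul_le_mul_of_nonneg_left hGp' hr0
    have hsplit : β / t * ((1 - t) * ψ x + t * G y) = (β / t - β) * ψ x + β * G y := by
      linear_combination (G y - ψ x) * hrt
    linarith
  refine ⟨hG.1, fun x hx y hy α β hα hβ hαβ => ?_⟩
  by_cases hq : A (α • x + β • y) < z
  · simp only [if_pos hq, smul_eq_mul]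
    split_ifs with hxz hyz hyz
    · exact hψ.2 ⟨hx, hxz.le⟩ ⟨hy, hyz.le⟩ hα hβ hαβ
    · exact mixed x hx y hy hxz (not_lt.1 hyz) α β hα hβ hαβ hq
    · rw [add_comm (α * _), add_comm (α • x)]
      rw [add_comm (α • x)] at hq
      exact mixed y hy x hx hyz (not_lt.1 hxz) β α hβ hα (by linarith) hq
    · exfalso
      simp only [map_add, map_smul, smul_eq_mul] at hq
      have hx' := mul_le_mul_of_nonneg_left (not_lt.1 hxz) hα
      have hy' := mul_le_mul_of_nonneg_left (not_lt.1 hyz) hβ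
      have : α * z + β * z = z := by rw [← add_mul, hαβ, one_mul]
      linarith
  · simp only [if_neg hq]
    refine le_trans ?_ (hG.2 hx hy hα hβ hαβ)
    exact add_le_add (mul_le_mul_of_nonneg_left (h_le_G x hx) hα)
      (mul_le_mul_of_nonneg_left (h_le_G y hy) hβ)

theorem stmt10 {n : ℕ} (w : Fin (n+1) → ℝ) (hw : ∀ i, 0 < w i) (b : ℝ)
    (σ : ℝ → ℝ) (hσ : Continuous σ) (hSTFE : STFE σ)
    (zhat : ℝ) (htie : IsTiePoint σ b ((∑ i, w i) + b) zhat)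
    (i : Fin (n+1)) (hne : (Ri w b zhat i).Nonempty)
    (φ ψ : (Fin n → ℝ) → ℝ)
    (hφ : IsConcaveEnvelope (Set.Icc 0 1)
      (fun y : Fin n → ℝ => σ ((∑ j, w (i.succAbove j) * y j) + w i + b)) φ)
    (hψ : IsConcaveEnvelope
      (Set.Icc 0 1 ∩ {y : Fin n → ℝ | (∑ j, w (i.succAbove j) * y j) + w i + b ≤ zhat})
      (fun y : Fin n → ℝ => σ ((∑ j, w (i.succAbove j) * y j) + w i + b)) ψ) :
    ∀ y ∈ Set.Icc (0 : Fin n → ℝ) 1,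
      (∑ j, w (i.succAbove j) * y j) + w i + b ≤ zhat → φ y = ψ y := by
  obtain ⟨⟨hz, hgc, hgσ, -⟩, -⟩ := htie
  set g : ℝ → ℝ := fun z =>
    if z < zhat then σ b + (σ zhat - σ b) / (zhat - b) * (z - b) else σ z with hg
  have g_of_le : ∀ z, zhat ≤ z → g z = σ z := fun z h => if_neg (not_lt.2 h)
  let A : (Fin n → ℝ) →ₗ[ℝ] ℝ := ∑ j, w (i.succAbove j) • LinearMap.proj j
  have hA : ∀ y, ∑ j, w (i.succAbove j) * y j = A y := by
    intro y
    simp [A]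
  simp only [hA] at hφ hψ ⊢
  obtain ⟨hφc, hφf, hφmin⟩ := hφ
  obtain ⟨hψc, hψf, hψmin⟩ := hψ
  have hmem : ∀ y ∈ Set.Icc (0 : Fin n → ℝ) 1, A y + w i + b ∈ Set.Icc b ((∑ i, w i) + b) := by
    intro y hy
    have h0 : 0 ≤ A y := by
      rw [← hA]
      exact Finset.sum_nonneg fun j _ => mul_nonneg (hw _).le (hy.1 j)
    have h1 : A y ≤ ∑ j, w (i.succAbove j) := by
      rw [← hA]
      exact Finset.sum_le_sum fun j _ => mul_le_of_le_one_right (hw _).le (hy.2 j)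
    have := hw i
    rw [Fin.sum_univ_succAbove w i]
    constructor <;> linarith
  have hGc : ConcaveOn ℝ (Set.Icc (0 : Fin n → ℝ) 1) (fun y => g (A y + w i + b)) := by
    refine ⟨convex_Icc 0 1, fun x hx y hy α β hα hβ hαβ => ?_⟩
    have h := hgc.2 (hmem x hx) (hmem y hy) hα hβ hαβ
    refine h.trans_eq (congrArg g ?_)
    simp only [map_add, map_smul, smul_eq_mul]
    linear_combination (w i + b) * hαβ
  have hset : Set.Icc (0 : Fin n → ℝ) 1 ∩ {y | A y + w i + b ≤ zhat} =
      Set.Icc 0 1 ∩ {y | A y ≤ zhat - w i - b} := by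
    ext y
    simp only [Set.mem_inter_iff, Set.mem_ofPred_eq]
    exact and_congr_right fun _ => by constructor <;> intro h <;> linarith
  have hψg : ∀ y ∈ Set.Icc (0 : Fin n → ℝ) 1, A y + w i + b ≤ zhat →
      ψ y ≤ g (A y + w i + b) := fun y hy hyz =>
    hψmin _ (hGc.subset Set.inter_subset_left hψc.1) (fun x hx => hgσ _ (hmem x hx.1)) y ⟨hy, hyz⟩
  have hψeq : ∀ y ∈ Set.Icc (0 : Fin n → ℝ) 1, A y + w i + b = zhat →
      ψ y = g (A y + w i + b) := fun y hy hyz =>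
    (hψg y hy hyz.le).antisymm ((g_of_le _ hyz.ge).trans_le (hψf y ⟨hy, hyz.le⟩))
  have hglue := ConcaveOn.ite_lt_of_le (hset ▸ hψc) hGc
    (fun y hy h => hψg y hy (by linarith)) (fun y hy h => hψeq y hy (by linarith))
  intro y hy hyz
  apply le_antisymm
  · have h := hφmin _ hglue (fun x hx => ?_) y hy
    · refine h.trans ?_
      split_ifs with hlt
      · exact le_rfl
      · exact (hψeq y hy (by linarith)).ge
    · split_ifs with hlt
      · exact hψf x ⟨hx, show A x + w i + b ≤ zhat by linarith⟩
      · exact hgσ _ (hmem x hx)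
  · exact hψmin φ (hφc.subset Set.inter_subset_left hψc.1) (fun x hx => hφf x hx.1) y ⟨hy, hyz⟩
end
end

section
/- Let w ∈ ℝ^n have all entries strictly positive, b ∈ ℝ, σ : ℝ → ℝ continuous satisfying the STFE property with σ(b) = 0, and f(x) = σ(wᵀx + b) on [0,1]^n. Then the piecewise-defined function g (equal to f on R_f, to (σ(ẑ)/(ẑ−b))·wᵀx on R_l, and to x_i·conc(f_{−i},[0,1]^{n−1})(x_{−i}/x_i) on each R_i) is continuous on [0,1]^n. -/
noncomputable section

theorem IsConcaveEnvelope.le_comp_add {E E' : Type*} [AddCommGroup E] [Module ℝ E]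
    [AddCommGroup E'] [Module ℝ E'] {S : Set E} {S' : Set E'} {f φ : E → ℝ} {f' φ' : E' → ℝ}
    (hφ : IsConcaveEnvelope S f φ) (hφ' : ConcaveOn ℝ S' φ') (hf' : ∀ y ∈ S', f' y ≤ φ' y)
    (T : E → E') (hT : ∀ x y : E, ∀ s t : ℝ, s + t = 1 → T (s • x + t • y) = s • T x + t • T y)
    (hTS : ∀ x ∈ S, T x ∈ S') (l : E → ℝ)
    (hl : ∀ x y : E, ∀ s t : ℝ, s + t = 1 → l (s • x + t • y) = s * l x + t * l y)
    (hfl : ∀ x ∈ S, f x ≤ f' (T x) + l x) {x : E} (hx : x ∈ S) : φ x ≤ φ' (T x) + l x := by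
  refine hφ.2.2 (fun x => φ' (T x) + l x) ⟨hφ.1.1, ?_⟩ ?_ x hx
  · intro x hx y hy s t hs ht hst
    have := hφ'.2 (hTS x hx) (hTS y hy) hs ht hst
    simp only [hT x y s t hst, hl x y s t hst, smul_eq_mul] at this ⊢
    linarith
  · intro x hx
    exact (hfl x hx).trans (by linarith [hf' _ (hTS x hx)])

/-- A continuous function on a compact interval is Lipschitz up to an arbitrarily small error. -/
theorem ContinuousOn.exists_le_add_mul_abs_sub {σ : ℝ → ℝ} {a c : ℝ}
    (hσ : ContinuousOn σ (Set.Icc a c)) {ε : ℝ} (hε : 0 < ε) :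
    ∃ M : ℝ, 0 ≤ M ∧ ∀ s ∈ Set.Icc a c, ∀ t ∈ Set.Icc a c, σ s ≤ σ t + ε + M * |s - t| := by
  obtain ⟨K, hK⟩ := isCompact_Icc.exists_bound_of_continuousOn hσ
  obtain ⟨δ, hδ, h⟩ := Metric.uniformContinuousOn_iff.1
    (isCompact_Icc.uniformContinuousOn_of_continuous hσ) ε hε
  refine ⟨2 * |K| / δ, by positivity, fun s hs t ht => ?_⟩
  by_cases hst : |s - t| < δ
  · have h1 := (abs_lt.1 (h s hs t ht hst)).2
    have : 0 ≤ 2 * |K| / δ * |s - t| := by positivity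
    linarith
  · have h1 := (abs_le.1 ((hK s hs).trans (le_abs_self K))).2
    have h2 := (abs_le.1 ((hK t ht).trans (le_abs_self K))).1
    have h3 : 2 * |K| / δ * δ ≤ 2 * |K| / δ * |s - t| :=
      mul_le_mul_of_nonneg_left (not_lt.1 hst) (by positivity)
    rw [div_mul_cancel₀ _ hδ.ne'] at h3
    linarith

/-- An affine self-map of `[0,1]` sending `a` to `c` whose displacement is dominated by an affine
function that is tight at `a`. -/
theorem exists_affine_Icc_map {a c : ℝ} (ha : a ∈ Set.Icc (0 : ℝ) 1)
    (hc : c ∈ Set.Icc (0 : ℝ) 1) :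
    ∃ p q u v : ℝ, p * a + q = c ∧ u * a + v = |a - c| ∧
      ∀ s ∈ Set.Icc (0 : ℝ) 1, p * s + q ∈ Set.Icc (0 : ℝ) 1 ∧ |s - (p * s + q)| ≤ u * s + v := by
  obtain ⟨ha0, ha1⟩ := ha
  obtain ⟨hc0, hc1⟩ := hc
  rcases lt_trichotomy a c with h | h | h
  · have h1 : 0 < 1 - a := by linarith
    obtain ⟨r, hr⟩ : ∃ r, r = (1 - c) / (1 - a) := ⟨_, rfl⟩
    have hra : r * (1 - a) = 1 - c := by rw [hr]; field_simp
    have hr0 : 0 ≤ r := by rw [hr]; exact div_nonneg (by linarith) h1.le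
    have hr1 : r ≤ 1 := by rw [hr, div_le_one h1]; linarith
    refine ⟨r, 1 - r, r - 1, 1 - r, by linarith, ?_, ?_⟩
    · rw [abs_of_neg (by linarith)]; linarith
    · rintro s ⟨hs0, hs1⟩
      refine ⟨⟨by nlinarith, by nlinarith⟩, ?_⟩
      rw [abs_le]
      constructor <;> nlinarith
  · exact ⟨1, 0, 0, 0, by linarith, by simp [h], fun s hs => by simpa using hs⟩
  · have h1 : 0 < a := by linarith
    obtain ⟨r, hr⟩ : ∃ r, r = c / a := ⟨_, rfl⟩
    have hra : r * a = c := by rw [hr]; field_simp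
    have hr0 : 0 ≤ r := by rw [hr]; positivity
    have hr1 : r ≤ 1 := by rw [hr, div_le_one h1]; linarith
    refine ⟨r, 0, 1 - r, 0, by linarith, ?_, ?_⟩
    · rw [abs_of_pos (by linarith)]; linarith
    · rintro s ⟨hs0, hs1⟩
      refine ⟨⟨by nlinarith, by nlinarith⟩, ?_⟩
      rw [abs_le]
      constructor <;> nlinarith

theorem IsConcaveEnvelope.continuousOn_cube {n : ℕ} {f φ : (Fin n → ℝ) → ℝ}
    (hφ : IsConcaveEnvelope (Set.Icc 0 1) f φ)
    (hf : ∀ ε > 0, ∃ M : ℝ, 0 ≤ M ∧ ∀ y ∈ Set.Icc (0 : Fin n → ℝ) 1,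
      ∀ z ∈ Set.Icc (0 : Fin n → ℝ) 1, f y ≤ f z + ε + M * ∑ k, |y k - z k|) :
    ContinuousOn φ (Set.Icc 0 1) := by
  have key : ∀ ε > 0, ∃ M : ℝ, 0 ≤ M ∧ ∀ y ∈ Set.Icc (0 : Fin n → ℝ) 1,
      ∀ z ∈ Set.Icc (0 : Fin n → ℝ) 1, φ y ≤ φ z + ε + M * ∑ k, |y k - z k| := by
    intro ε hε
    obtain ⟨M, hM, h⟩ := hf ε hε
    refine ⟨M, hM, fun y hy z hz => ?_⟩
    choose p q u v hpq huv hmap using fun k : Fin n =>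
      exists_affine_Icc_map ⟨hy.1 k, hy.2 k⟩ ⟨hz.1 k, hz.2 k⟩
    have hTS : ∀ x ∈ Set.Icc (0 : Fin n → ℝ) 1,
        (fun k => p k * x k + q k) ∈ Set.Icc (0 : Fin n → ℝ) 1 := fun x hx =>
      ⟨fun k => (hmap k (x k) ⟨hx.1 k, hx.2 k⟩).1.1, fun k => (hmap k (x k) ⟨hx.1 k, hx.2 k⟩).1.2⟩
    have := hφ.le_comp_add hφ.1 hφ.2.1 (fun x k => p k * x k + q k) ?_ hTS
      (fun x => ε + M * ∑ k, (u k * x k + v k)) ?_ ?_ hy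
    · simp only [hpq, huv] at this
      linarith
    · intro x x' s t hst
      obtain rfl : t = 1 - s := by linarith
      funext k
      simp only [Pi.add_apply, Pi.smul_apply, smul_eq_mul]
      ring
    · intro x x' s t hst
      obtain rfl : t = 1 - s := by linarith
      have : ∑ k, (u k * (s • x + (1 - s) • x') k + v k)
          = s * ∑ k, (u k * x k + v k) + (1 - s) * ∑ k, (u k * x' k + v k) := by
        rw [Finset.mul_sum, Finset.mul_sum, ← Finset.sum_add_distrib]
        refine Finset.sum_congr rfl fun k _ => ?_
        simp only [Pi.add_apply, Pi.smul_apply, smul_eq_mul]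
        ring
      rw [this]
      ring
    · intro x hx
      have h1 := h x hx _ (hTS x hx)
      have h2 : M * ∑ k, |x k - (p k * x k + q k)| ≤ M * ∑ k, (u k * x k + v k) :=
        mul_le_mul_of_nonneg_left
          (Finset.sum_le_sum fun k _ => (hmap k (x k) ⟨hx.1 k, hx.2 k⟩).2) hM
      linarith
  rw [Metric.continuousOn_iff]
  intro z hz ε hε
  obtain ⟨M, hM, h⟩ := key (ε / 2) (by positivity)
  have hsmall : ∀ᶠ y : Fin n → ℝ in nhds z, M * ∑ k, |y k - z k| < ε / 2 := by
    have hc : Continuous fun y : Fin n → ℝ => M * ∑ k, |y k - z k| := by fun_prop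
    refine hc.continuousAt.eventually_lt continuousAt_const ?_
    simpa using hε
  obtain ⟨δ, hδ, hball⟩ := Metric.eventually_nhds_iff.1 hsmall
  refine ⟨δ, hδ, fun y hy hyz => ?_⟩
  have h1 := h y hy z hz
  have h2 := h z hz y hy
  simp only [fun k => abs_sub_comm (z k) (y k)] at h2
  rw [Real.dist_eq, abs_lt]
  constructor <;> linarith [hball hyz]

section Facets

variable {n : ℕ} {w : Fin (n + 1) → ℝ} {b : ℝ} {σ : ℝ → ℝ}

theorem add_sum_succAbove_mem_Icc (hw : ∀ i, 0 < w i) (i : Fin (n + 1)) {y : Fin n → ℝ}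
    (hy : y ∈ Set.Icc (0 : Fin n → ℝ) 1) :
    (∑ j, w (i.succAbove j) * y j) + w i + b ∈ Set.Icc b ((∑ i, w i) + b) := by
  have h0 : 0 ≤ ∑ j, w (i.succAbove j) * y j :=
    Finset.sum_nonneg fun j _ => mul_nonneg (hw _).le (hy.1 j)
  have h1 : ∑ j, w (i.succAbove j) * y j ≤ ∑ j, w (i.succAbove j) :=
    Finset.sum_le_sum fun j _ => mul_le_of_le_one_right (hw _).le (hy.2 j)
  rw [Fin.sum_univ_succAbove w i]
  constructor <;> linarith [hw i]

theorem continuousOn_facet_envelope (hw : ∀ i, 0 < w i) (hσ : Continuous σ)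
    {i : Fin (n + 1)} {φ : (Fin n → ℝ) → ℝ}
    (hφ : IsConcaveEnvelope (Set.Icc 0 1)
      (fun y : Fin n → ℝ => σ ((∑ j, w (i.succAbove j) * y j) + w i + b)) φ) :
    ContinuousOn φ (Set.Icc 0 1) := by
  refine hφ.continuousOn_cube fun ε hε => ?_
  obtain ⟨M, hM, h⟩ := (hσ.continuousOn (s := Set.Icc b ((∑ i, w i) + b))).exists_le_add_mul_abs_sub
    hε
  have hW : 0 ≤ ∑ i, w i := Finset.sum_nonneg fun i _ => (hw i).le
  refine ⟨M * ∑ i, w i, by positivity, fun y hy z hz => ?_⟩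
  have h1 := h _ (add_sum_succAbove_mem_Icc hw i hy) _ (add_sum_succAbove_mem_Icc hw i hz)
  have h2 : |(∑ j, w (i.succAbove j) * y j) + w i + b - ((∑ j, w (i.succAbove j) * z j) + w i + b)|
      ≤ (∑ i, w i) * ∑ k, |y k - z k| := by
    rw [add_sub_add_right_eq_sub, add_sub_add_right_eq_sub, ← Finset.sum_sub_distrib,
      Finset.mul_sum]
    refine (Finset.abs_sum_le_sum_abs _ _).trans (Finset.sum_le_sum fun k _ => ?_)
    rw [← mul_sub, abs_mul, abs_of_pos (hw _)]
    exact mul_le_mul_of_nonneg_right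
      (Finset.single_le_sum (fun i _ => (hw i).le) (Finset.mem_univ _)) (abs_nonneg _)
  have h3 := mul_le_mul_of_nonneg_left h2 hM
  linarith

theorem facet_envelope_eq_of_eq_tie (hw : ∀ i, 0 < w i) {zhat : ℝ}
    (hz : STFEwitness σ b ((∑ i, w i) + b) zhat)
    {i : Fin (n + 1)} {φ : (Fin n → ℝ) → ℝ}
    (hφ : IsConcaveEnvelope (Set.Icc 0 1)
      (fun y : Fin n → ℝ => σ ((∑ j, w (i.succAbove j) * y j) + w i + b)) φ)
    {y : Fin n → ℝ} (hy : y ∈ Set.Icc (0 : Fin n → ℝ) 1)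
    (hyz : (∑ j, w (i.succAbove j) * y j) + w i + b = zhat) : φ y = σ zhat := by
  refine le_antisymm ?_ (by simpa only [hyz] using hφ.2.1 y hy)
  have := hφ.le_comp_add hz.2.1 hz.2.2.1
    (fun y => (∑ j, w (i.succAbove j) * y j) + w i + b) ?_
    (fun y hy => add_sum_succAbove_mem_Icc hw i hy) (fun _ => 0) (by simp) (by simp) hy
  · simpa [hyz] using this
  · intro x x' s t hst
    obtain rfl : t = 1 - s := by linarith
    have : ∑ j, w (i.succAbove j) * (s • x + (1 - s) • x') j
        = s * ∑ j, w (i.succAbove j) * x j + (1 - s) * ∑ j, w (i.succAbove j) * x' j := by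
      rw [Finset.mul_sum, Finset.mul_sum, ← Finset.sum_add_distrib]
      refine Finset.sum_congr rfl fun k _ => ?_
      simp only [Pi.add_apply, Pi.smul_apply, smul_eq_mul]
      ring
    simp only [this, smul_eq_mul]
    ring

/-- On the common face of two facets, the two facet envelopes agree (one inequality). -/
theorem facet_envelope_le (hw : ∀ i, 0 < w i) (hσ : Continuous σ)
    {i j : Fin (n + 1)} {φ φ' : (Fin n → ℝ) → ℝ}
    (hφ : IsConcaveEnvelope (Set.Icc 0 1)
      (fun y : Fin n → ℝ => σ ((∑ k, w (i.succAbove k) * y k) + w i + b)) φ)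
    (hφ' : IsConcaveEnvelope (Set.Icc 0 1)
      (fun y : Fin n → ℝ => σ ((∑ k, w (j.succAbove k) * y k) + w j + b)) φ')
    {x : Fin (n + 1) → ℝ} (hx : x ∈ Set.Icc (0 : Fin (n + 1) → ℝ) 1) (hi : x i = 1)
    (hj : x j = 1) :
    φ (fun k => x (i.succAbove k)) ≤ φ' (fun k => x (j.succAbove k)) := by
  refine le_of_forall_pos_le_add fun ε hε => ?_
  obtain ⟨M, hM, h⟩ := (hσ.continuousOn (s := Set.Icc b ((∑ i, w i) + b))).exists_le_add_mul_abs_sub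
    hε
  have hins : ∀ y ∈ Set.Icc (0 : Fin n → ℝ) 1, ∀ k,
      (i.insertNth 1 y : Fin (n + 1) → ℝ) k ∈ Set.Icc (0 : ℝ) 1 := by
    intro y hy k
    rcases Fin.eq_self_or_eq_succAbove i k with rfl | ⟨k, rfl⟩
    · simp
    · simpa using ⟨hy.1 k, hy.2 k⟩
  have haff : ∀ (y y' : Fin n → ℝ) (s : ℝ) (k : Fin (n + 1)),
      (i.insertNth 1 (s • y + (1 - s) • y') : Fin (n + 1) → ℝ) k
        = s * (i.insertNth 1 y : Fin (n + 1) → ℝ) k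
          + (1 - s) * (i.insertNth 1 y' : Fin (n + 1) → ℝ) k := by
    intro y y' s k
    rcases Fin.eq_self_or_eq_succAbove i k with rfl | ⟨k, rfl⟩
    · simp
    · simp
  have hTS : ∀ y ∈ Set.Icc (0 : Fin n → ℝ) 1,
      (fun k => (i.insertNth 1 y : Fin (n + 1) → ℝ) (j.succAbove k))
        ∈ Set.Icc (0 : Fin n → ℝ) 1 := fun y hy =>
    ⟨fun k => (hins y hy _).1, fun k => (hins y hy _).2⟩
  have hxi : (i.insertNth 1 (fun k => x (i.succAbove k)) : Fin (n + 1) → ℝ) = x := by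
    funext k
    rcases Fin.eq_self_or_eq_succAbove i k with rfl | ⟨k, rfl⟩
    · simp [hi]
    · simp
  have hxS : (fun k => x (i.succAbove k)) ∈ Set.Icc (0 : Fin n → ℝ) 1 :=
    ⟨fun k => hx.1 _, fun k => hx.2 _⟩
  have := hφ.le_comp_add hφ'.1 hφ'.2.1
    (fun y k => (i.insertNth 1 y : Fin (n + 1) → ℝ) (j.succAbove k)) ?_ hTS
    (fun y => ε + M * (w j * (1 - (i.insertNth 1 y : Fin (n + 1) → ℝ) j))) ?_ ?_ hxS
  · simpa [hxi, hj] using this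
  · intro y y' s t hst
    obtain rfl : t = 1 - s := by linarith
    funext k
    simp only [haff, Pi.add_apply, Pi.smul_apply, smul_eq_mul]
  · intro y y' s t hst
    obtain rfl : t = 1 - s := by linarith
    simp only [haff]
    ring
  · intro y hy
    have h1 := h _ (add_sum_succAbove_mem_Icc hw i hy) _
      (add_sum_succAbove_mem_Icc hw j (hTS y hy))
    have h2 := Fin.sum_univ_succAbove (fun k => w k * (i.insertNth 1 y : Fin (n + 1) → ℝ) k) i
    rw [Fin.sum_univ_succAbove _ j] at h2
    simp only [Fin.insertNth_apply_same, Fin.insertNth_apply_succAbove, mul_one] at h2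
    have h3 : |(∑ k, w (i.succAbove k) * y k) + w i + b -
        ((∑ k, w (j.succAbove k) * (i.insertNth 1 y : Fin (n + 1) → ℝ) (j.succAbove k))
          + w j + b)| = w j * (1 - (i.insertNth 1 y : Fin (n + 1) → ℝ) j) := by
      rw [abs_sub_comm, abs_of_nonneg]
      · linarith
      · have := mul_nonneg (hw j).le (sub_nonneg.2 (hins y hy j).2)
        linarith
    rw [h3] at h1
    linarith

end Facets

theorem norm_eq_of_forall_le {m : ℕ} {x : Fin m → ℝ} (hx : 0 ≤ x) {i : Fin m}
    (hi : ∀ j, x j ≤ x i) : ‖x‖ = x i := by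
  refine le_antisymm ((pi_norm_le_iff_of_nonneg (hx i)).2 fun j => ?_)
    ((le_abs_self _).trans (norm_le_pi_norm x i))
  rw [Real.norm_of_nonneg (hx j)]
  exact hi j

theorem exists_first_argmax {m : ℕ} (x : Fin (m + 1) → ℝ) :
    ∃ i, (∀ j, x j ≤ x i) ∧ ∀ j, j < i → x j < x i := by
  classical
  obtain ⟨i₀, hi₀⟩ := Finite.exists_max x
  obtain ⟨i, hi, hmin⟩ := WellFounded.has_min (wellFounded_lt (α := Fin (m + 1)))
    {i | ∀ j, x j ≤ x i} ⟨i₀, hi₀⟩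
  refine ⟨i, hi, fun j hj => lt_of_not_ge fun h => hmin j (fun k => (hi k).trans h) hj⟩

theorem div_mem_cube {m : ℕ} {x : Fin m → ℝ} (hx : 0 ≤ x) {i : Fin m} (hi : ∀ j, x j ≤ x i)
    (j : Fin m) : x j / x i ∈ Set.Icc (0 : ℝ) 1 :=
  ⟨div_nonneg (hx j) (hx i), div_le_one_of_le₀ (hi j) (hx i)⟩

/-- Homogeneous extension of a function on the facet `x i = 1` to the cone over that facet. -/
theorem continuousOn_perspective {n : ℕ} {i : Fin (n + 1)} {φ : (Fin n → ℝ) → ℝ}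
    (hφ : ContinuousOn φ (Set.Icc 0 1)) :
    ContinuousOn (fun x : Fin (n + 1) → ℝ => x i * φ (fun j => x (i.succAbove j) / x i))
      {x | 0 ≤ x ∧ ∀ j, x j ≤ x i} := by
  have hmaps : ∀ x ∈ {x : Fin (n + 1) → ℝ | 0 ≤ x ∧ ∀ j, x j ≤ x i},
      (fun j => x (i.succAbove j) / x i) ∈ Set.Icc (0 : Fin n → ℝ) 1 := fun x hx =>
    ⟨fun j => (div_mem_cube hx.1 hx.2 _).1, fun j => (div_mem_cube hx.1 hx.2 _).2⟩
  intro x hx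
  rcases (hx.1 i).eq_or_lt with h0 | h0
  · obtain ⟨K, hK⟩ := isCompact_Icc.exists_bound_of_continuousOn hφ
    simp only [Pi.zero_apply] at h0
    rw [ContinuousWithinAt, ← h0, zero_mul]
    have hlim : Filter.Tendsto (fun y : Fin (n + 1) → ℝ => y i * K)
        (nhdsWithin x {x | 0 ≤ x ∧ ∀ j, x j ≤ x i}) (nhds 0) := by
      have : Continuous fun y : Fin (n + 1) → ℝ => y i * K := by fun_prop
      simpa [← h0] using (this.tendsto x).mono_left nhdsWithin_le_nhds
    refine squeeze_zero_norm' ?_ hlim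
    filter_upwards [self_mem_nhdsWithin] with y hy
    rw [norm_mul, Real.norm_of_nonneg (hy.1 i)]
    exact mul_le_mul_of_nonneg_left (hK _ (hmaps y hy)) (hy.1 i)
  · refine (continuous_apply i).continuousWithinAt.mul ?_
    refine ContinuousWithinAt.comp (t := Set.Icc 0 1) (hφ _ (hmaps x hx)) ?_ hmaps
    refine continuousWithinAt_pi.2 fun j => ?_
    exact (continuous_apply _).continuousWithinAt.div (continuous_apply i).continuousWithinAt h0.ne'

theorem stmt11 {n : ℕ} (w : Fin (n+1) → ℝ) (hw : ∀ i, 0 < w i) (b : ℝ)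
    (σ : ℝ → ℝ) (hσ : Continuous σ) (hSTFE : STFE σ) (hb : σ b = 0)
    (zhat : ℝ) (htie : IsTiePoint σ b ((∑ i, w i) + b) zhat)
    (ψ : Fin (n+1) → (Fin n → ℝ) → ℝ)
    (hψ : ∀ i, IsConcaveEnvelope (Set.Icc 0 1)
      (fun y : Fin n → ℝ => σ ((∑ j, w (i.succAbove j) * y j) + w i + b)) (ψ i))
    (g : (Fin (n+1) → ℝ) → ℝ)
    (hgf : ∀ x ∈ Rf w b zhat, g x = σ (dotp w x + b))
    (hgl : ∀ x ∈ Rl w b zhat, g x = σ zhat / (zhat - b) * dotp w x)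
    (hgi : ∀ i : Fin (n+1), ∀ x ∈ Ri w b zhat i,
      g x = x i * ψ i (fun j => x (i.succAbove j) / x i)) :
    ContinuousOn g (Set.Icc (0 : Fin (n+1) → ℝ) 1) := by
  have hcube : IsClosed (Set.Icc (0 : Fin (n + 1) → ℝ) 1) := isClosed_Icc
  have hdot : Continuous (dotp w) := by unfold dotp; fun_prop
  have hf : ContinuousOn g (Rf w b zhat) :=
    ContinuousOn.congr (f := fun x => σ (dotp w x + b)) (by fun_prop) hgf
  rcases htie.1.1.1.eq_or_lt with hbz | hbz
  · refine hf.mono fun x hx => ⟨hx, ?_⟩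
    have : 0 ≤ dotp w x := Finset.sum_nonneg fun i _ => mul_nonneg (hw i).le (hx.1 i)
    linarith
  have hz0 : 0 < zhat - b := sub_pos.2 hbz
  let Cl : Set (Fin (n + 1) → ℝ) :=
    {x | x ∈ Set.Icc 0 1 ∧ dotp w x + b ≤ zhat ∧ zhat * ‖x‖ ≤ dotp w x + b * ‖x‖}
  let C : Fin (n + 1) → Set (Fin (n + 1) → ℝ) := fun i =>
    {x | x ∈ Set.Icc 0 1 ∧ dotp w x + b * ‖x‖ ≤ zhat * ‖x‖ ∧ ∀ j, x j ≤ x i}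
  have hgl' : ∀ x ∈ Cl, g x = σ zhat / (zhat - b) * dotp w x := by
    rintro x ⟨hx, h1, h2⟩
    rcases h1.eq_or_lt with h1 | h1
    · rw [hgf x ⟨hx, h1.ge⟩, h1, ← h1, add_sub_cancel_right, div_mul_cancel₀]
      linarith
    · exact hgl x ⟨hx, h1, h2⟩
  have hgi' : ∀ i, ∀ x ∈ C i, g x = x i * ψ i (fun j => x (i.succAbove j) / x i) := by
    rintro i x ⟨hx, h1, h2⟩
    have hnorm := norm_eq_of_forall_le hx.1 h2
    have hdiv := div_mem_cube hx.1 h2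
    rcases h1.eq_or_lt with h1 | h1
    · have hxl : x ∈ Cl := by
        refine ⟨hx, ?_, h1.ge⟩
        have : (zhat - b) * x i ≤ (zhat - b) * 1 := mul_le_mul_of_nonneg_left (hx.2 i) hz0.le
        rw [hnorm] at h1
        linarith
      have hd : dotp w x = (zhat - b) * x i := by rw [hnorm] at h1; linarith
      rw [hgl' x hxl, hd]
      rcases (hx.1 i).eq_or_lt with h0 | h0
      · simp only [Pi.zero_apply] at h0
        simp [← h0]
      · simp only [Pi.zero_apply] at h0
        rw [facet_envelope_eq_of_eq_tie hw htie.1 (hψ i)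
          ⟨fun j => (hdiv _).1, fun j => (hdiv _).2⟩]
        · field_simp
        · rw [dotp, Fin.sum_univ_succAbove _ i] at hd
          simp only [mul_div_assoc', ← Finset.sum_div]
          field_simp
          linarith
    · obtain ⟨k, hk, hk'⟩ := exists_first_argmax x
      have hki : x k = x i := le_antisymm (h2 k) (hk i)
      have h0 : 0 < x i := by
        refine (hx.1 i).lt_of_ne fun h => ?_
        have hx0 : x = 0 := funext fun j => le_antisymm (by simpa [← h] using h2 j) (hx.1 j)
        simp [hx0, dotp] at h1
      rw [hgi k x ⟨hx, h1, hk', fun j _ => hk j⟩, hki]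
      have hy : (fun j => x j / x i) ∈ Set.Icc (0 : Fin (n + 1) → ℝ) 1 :=
        ⟨fun j => (hdiv j).1, fun j => (hdiv j).2⟩
      have hyi : (fun j => x j / x i) i = 1 := div_self h0.ne'
      have hyk : (fun j => x j / x i) k = 1 := by simp only [hki]; exact div_self h0.ne'
      exact congrArg (x i * ·) (le_antisymm
        (facet_envelope_le hw hσ (hψ k) (hψ i) hy hyk hyi)
        (facet_envelope_le hw hσ (hψ i) (hψ k) hy hyi hyk))
  have hRf : IsClosed (Rf w b zhat) :=
    hcube.inter (isClosed_le continuous_const (hdot.add continuous_const))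
  have hCl : IsClosed Cl :=
    hcube.inter ((isClosed_le (f := fun x => dotp w x + b) (g := fun _ => zhat)
      (by fun_prop) (by fun_prop)).inter (isClosed_le (f := fun x => zhat * ‖x‖)
      (g := fun x => dotp w x + b * ‖x‖) (by fun_prop) (by fun_prop)))
  have hC : ∀ i, IsClosed (C i) := fun i => by
    have hmax : IsClosed {x : Fin (n + 1) → ℝ | ∀ j, x j ≤ x i} := by
      simp only [Set.ofPred_forall]
      exact isClosed_iInter fun j => isClosed_le (continuous_apply j) (continuous_apply i)
    exact hcube.inter ((isClosed_le (f := fun x => dotp w x + b * ‖x‖) (g := fun x => zhat * ‖x‖)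
      (by fun_prop) (by fun_prop)).inter hmax)
  have hl : ContinuousOn g Cl :=
    ContinuousOn.congr (f := fun x => σ zhat / (zhat - b) * dotp w x) (by fun_prop) hgl'
  have hi : ∀ i, ContinuousOn g (C i) := fun i =>
    ((continuousOn_perspective (continuousOn_facet_envelope hw hσ (hψ i))).mono
      fun x hx => ⟨hx.1.1, hx.2.2⟩).congr (hgi' i)
  have hU : ContinuousOn g (⋃ i, C i) :=
    (locallyFinite_of_finite C).continuousOn_iUnion hC hi
  have hUc : IsClosed (⋃ i, C i) := isClosed_iUnion_of_finite hC
  refine ((hf.union_of_isClosed hl hRf hCl).union_of_isClosed hU (hRf.union hCl) hUc).mono ?_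
  intro x hx
  rcases le_total (dotp w x + b * ‖x‖) (zhat * ‖x‖) with h | h
  · obtain ⟨k, hk, -⟩ := exists_first_argmax x
    exact Or.inr (Set.mem_iUnion.2 ⟨k, hx, h, hk⟩)
  · rcases le_total zhat (dotp w x + b) with h' | h'
    · exact Or.inl (Or.inl ⟨hx, h'⟩)
    · exact Or.inl (Or.inr ⟨hx, h', h⟩)
end
end

section
/- Let w ∈ ℝ^n have all entries strictly positive, b ∈ ℝ, σ : ℝ → ℝ continuous satisfying the STFE property with σ(b) = 0, and f(x) = σ(wᵀx + b) on [0,1]^n. Then the piecewise-defined function g satisfies g(x) ≥ f(x) for all x ∈ [0,1]^n. -/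
noncomputable section

/-- On the secant part of a witness, `σ` lies below the secant. -/
lemma STFEwitness.le_secant {σ : ℝ → ℝ} {b u zhat z : ℝ} (h : STFEwitness σ b u zhat)
    (hb : σ b = 0) (hbz : b ≤ z) (hz : z < zhat) :
    σ z ≤ σ zhat / (zhat - b) * (z - b) := by
  have h1 := h.2.2.1 z ⟨hbz, hz.le.trans h.1.2⟩
  simpa [hz, hb] using h1

/-- Secant slopes of `σ` from the zero `b` are nondecreasing up to any STFE witness. -/
lemma STFE.slope_mono {σ : ℝ → ℝ} (hσ : Continuous σ) (hS : STFE σ) {b u zhat p s : ℝ}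
    (hb : σ b = 0) (hw : STFEwitness σ b u zhat) (hbp : b < p) (hps : p < s)
    (hs : s < zhat) : σ p * (s - b) ≤ σ s * (p - b) := by
  by_contra! hlt
  -- `D` vanishes at `b` and `p`, and `D s < 0 ≤ D zhat`.
  let D : ℝ → ℝ := fun z => σ z * (p - b) - σ p * (z - b)
  have hDs : D s < 0 := by simp only [D]; linarith
  have hD_of_secant : ∀ {v : ℝ}, p < v → σ p ≤ σ v / (v - b) * (p - b) → 0 ≤ D v := by
    intro v hpv h
    have hv : 0 < v - b := by linarith
    rw [div_mul_eq_mul_div, le_div_iff₀ hv] at h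
    simp only [D]; linarith
  have hDz : 0 ≤ D zhat :=
    hD_of_secant (hps.trans hs) (hw.le_secant hb hbp.le (hps.trans hs))
  have hDc : Continuous D := by fun_prop
  obtain ⟨q, ⟨⟨hsq, -⟩, hDq⟩, hqmin⟩ :=
    (isCompact_Icc.inter_right (isClosed_le continuous_const hDc) :
      IsCompact (Set.Icc s zhat ∩ {z | 0 ≤ D z})).exists_isLeast ⟨zhat, ⟨hs.le, le_rfl⟩, hDz⟩
  have hDq : 0 ≤ D q := hDq
  have hqz : q ≤ zhat := hqmin ⟨⟨hs.le, le_rfl⟩, hDz⟩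
  have hsq : s < q := hsq.lt_of_ne (by rintro rfl; linarith)
  have hconc : ∀ r ∈ Set.Ioo s q, (r - s) * σ p + (s - p) * σ r ≤ (r - p) * σ s := by
    intro r ⟨hsr, hrq⟩
    obtain ⟨v, hv⟩ := hS b r (by linarith)
    have hvs : v ≤ s := by
      by_contra! hsv
      have hDv := hD_of_secant (hps.trans hsv) (hv.le_secant hb hbp.le (hps.trans hsv))
      have : q ≤ v := hqmin ⟨⟨hsv.le, by linarith [hv.1.2]⟩, hDv⟩
      linarith [hv.1.2]
    have hrp : 0 < r - p := by linarith
    have hp : p ∈ Set.Icc b r := ⟨hbp.le, by linarith⟩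
    have h1 := hv.2.1.2 hp ⟨by linarith, le_rfl⟩ (div_nonneg (sub_nonneg.2 hsr.le) hrp.le)
      (div_nonneg (sub_nonneg.2 hps.le) hrp.le) (by field_simp; ring)
    have h2 : ((r - s) / (r - p)) • p + ((s - p) / (r - p)) • r = s := by
      simp only [smul_eq_mul]; field_simp; ring
    rw [h2] at h1
    have h3 := hv.2.2.1 p hp
    simp only [smul_eq_mul, not_lt.2 hvs, not_lt.2 (hvs.trans hsr.le), if_false] at h1
    have h4 := (mul_le_mul_of_nonneg_left h3 (div_nonneg (sub_nonneg.2 hsr.le) hrp.le))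
    have h5 := (add_le_add_left h4 _).trans h1
    have h6 : (r - s) / (r - p) * σ p + (s - p) / (r - p) * σ r
        = ((r - s) * σ p + (s - p) * σ r) / (r - p) := by ring
    rw [h6, div_le_iff₀ hrp] at h5
    linarith
  have hlim : (q - s) * σ p + (s - p) * σ q ≤ (q - p) * σ s := by
    have hcl : IsClosed {r | (r - s) * σ p + (s - p) * σ r ≤ (r - p) * σ s} :=
      isClosed_le (by fun_prop) (by fun_prop)
    have hq : q ∈ closure (Set.Ioo s q) := by
      rw [closure_Ioo hsq.ne]; exact ⟨hsq.le, le_rfl⟩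
    exact hcl.closure_subset_iff.2 hconc hq
  have key : (s - p) * D q ≤ (q - p) * D s := by
    simp only [D]
    nlinarith [mul_le_mul_of_nonneg_left hlim (sub_pos.2 hbp).le]
  nlinarith [mul_nonneg (sub_pos.2 hps).le hDq,
    mul_neg_of_pos_of_neg (sub_pos.2 (hps.trans hsq)) hDs]

/-- A nonnegative vector has a first coordinate attaining its sup norm. -/
lemma exists_first_max {n : ℕ} (x : Fin (n + 1) → ℝ) (hx : 0 ≤ x) :
    ∃ i, ‖x‖ = x i ∧ (∀ j, j < i → x j < x i) ∧ ∀ j, x j ≤ x i := by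
  obtain ⟨k, hk⟩ := Finite.exists_max x
  obtain ⟨i, hi, hmin⟩ := WellFounded.has_min (wellFounded_lt (α := Fin (n + 1)))
    {i | ∀ j, x j ≤ x i} ⟨k, hk⟩
  refine ⟨i, le_antisymm ?_ ?_, fun j hj => ?_, hi⟩
  · rw [pi_norm_le_iff_of_nonneg (hx i)]
    intro j
    rw [Real.norm_of_nonneg (hx j)]
    exact hi j
  · exact (le_abs_self _).trans (norm_le_pi_norm x i)
  · by_contra! h
    exact hmin j (fun l => (hi l).trans h) hj

theorem stmt12 {n : ℕ} (w : Fin (n+1) → ℝ) (hw : ∀ i, 0 < w i) (b : ℝ)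
    (σ : ℝ → ℝ) (hσ : Continuous σ) (hSTFE : STFE σ) (hb : σ b = 0)
    (zhat : ℝ) (htie : IsTiePoint σ b ((∑ i, w i) + b) zhat)
    (ψ : Fin (n+1) → (Fin n → ℝ) → ℝ)
    (hψ : ∀ i, IsConcaveEnvelope (Set.Icc 0 1)
      (fun y : Fin n → ℝ => σ ((∑ j, w (i.succAbove j) * y j) + w i + b)) (ψ i))
    (g : (Fin (n+1) → ℝ) → ℝ)
    (hgf : ∀ x ∈ Rf w b zhat, g x = σ (dotp w x + b))
    (hgl : ∀ x ∈ Rl w b zhat, g x = σ zhat / (zhat - b) * dotp w x)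
    (hgi : ∀ i : Fin (n+1), ∀ x ∈ Ri w b zhat i,
      g x = x i * ψ i (fun j => x (i.succAbove j) / x i)) :
    ∀ x ∈ Set.Icc (0 : Fin (n+1) → ℝ) 1, σ (dotp w x + b) ≤ g x := by
  intro x hx
  have hdot : 0 ≤ dotp w x :=
    Finset.sum_nonneg fun i _ => mul_nonneg (hw i).le (hx.1 i)
  by_cases h1 : zhat ≤ dotp w x + b
  · exact (hgf x ⟨hx, h1⟩).ge
  push Not at h1
  by_cases h2 : zhat * ‖x‖ ≤ dotp w x + b * ‖x‖
  · rw [hgl x ⟨hx, h1, h2⟩]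
    simpa using htie.1.le_secant hb (by linarith) h1
  push Not at h2
  obtain ⟨i, hnorm, hlt, hle⟩ := exists_first_max x hx.1
  rw [hgi i x ⟨hx, h2, hlt, fun j _ => hle j⟩]
  rw [hnorm] at h2
  have ht : 0 < x i := (hx.1 i).lt_of_ne' (by rintro h; simp only [h, Pi.zero_apply] at h2; linarith)
  have hψy := (hψ i).2.1 (fun j => x (i.succAbove j) / x i)
    ⟨fun j => div_nonneg (hx.1 _) ht.le, fun j => (div_le_one ht).2 (hle _)⟩
  set y := ψ i (fun j => x (i.succAbove j) / x i)
  set s := (∑ j, w (i.succAbove j) * (x (i.succAbove j) / x i)) + w i + b with hs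
  have hts : x i * (s - b) = dotp w x := by
    simp only [hs, dotp, Fin.sum_univ_succAbove _ i, add_sub_cancel_right, mul_add,
      Finset.mul_sum]
    rw [add_comm, mul_comm (x i) (w i)]
    congr 1
    refine Finset.sum_congr rfl fun j _ => ?_
    field_simp
  have hsz : s < zhat := by
    refine lt_of_mul_lt_mul_left ?_ ht.le
    linarith
  have hbs : b < s := by
    have : 0 ≤ ∑ j, w (i.succAbove j) * (x (i.succAbove j) / x i) :=
      Finset.sum_nonneg fun j _ => mul_nonneg (hw _).le (div_nonneg (hx.1 _) ht.le)
    linarith [hw i]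
  refine le_trans ?_ (mul_le_mul_of_nonneg_left hψy ht.le)
  have hsb : 0 < s - b := sub_pos.2 hbs
  rw [← hts]
  rcases (hx.2 i).lt_or_eq with h | h
  · simp only [Pi.one_apply] at h
    have := STFE.slope_mono hσ hSTFE hb htie.1 (p := x i * (s - b) + b)
      (by linarith [mul_pos ht hsb]) (by linarith [mul_lt_mul_of_pos_right h hsb]) hsz
    refine le_of_mul_le_mul_right ?_ hsb
    linarith
  · simp only [Pi.one_apply] at h
    simp only [h, one_mul, sub_add_cancel]
    exact le_of_eq (by simp [hs, h])
end
end
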